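/- arXiv:1208.2170 — 4 statements merged into one kernel-verified Lean document; each statement's English description precedes it below -/
import Mathlib

section
/- Let K be a non-cyclic cubic field with Galois closure K̃, and let p be a prime that is not totally ramified in K. Then v_p(Disc(K̃)) = 3·v_p(Disc(K)), where v_p denotes the exponent of p in the discriminant of the ring of integers. -/
open NumberField

/-- The prime `p` is totally ramified in the number field `K`:
`p·O_K = 𝔭³` for a single prime ideal `𝔭` of the ring of integers. -/
def TotallyRamifiedAt (p : ℕ) (K : Type*) [Field K] : Prop :=
  ∃ P : Ideal (𝓞 K), P.IsPrime ∧ Ideal.span {(p : 𝓞 K)} = P ^ 3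

open scoped Pointwise

theorem diff_smul (L : Type) [Field L] [NumberField L] (σ : Gal(L/ℚ)) :
    σ • differentIdeal ℤ (𝓞 L) = differentIdeal ℤ (𝓞 L) := by
  have key : ∀ x : 𝓞 L, x ∈ differentIdeal ℤ (𝓞 L) ↔ 
      ∀ y : L, (∀ z : 𝓞 L, ∃ n : ℤ, Algebra.trace ℚ L (y * z) = n) → ∃ w : 𝓞 L, (w : L) = x * y := by
    intro x
    have h := coeSubmodule_differentIdeal (L := L) (B := 𝓞 L) ℤ ℚ
    have h2 : x ∈ differentIdeal ℤ (𝓞 L) ↔ (x : L) ∈ IsLocalization.coeSubmodule L (differentIdeal ℤ (𝓞 L)) := by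
      rw [IsLocalization.mem_coeSubmodule]
      constructor
      · exact fun hx => ⟨x, hx, rfl⟩
      · rintro ⟨y, hy, hxy⟩
        have : y = x := FaithfulSMul.algebraMap_injective (𝓞 L) L hxy
        exact this ▸ hy
    rw [h2, h, Submodule.mem_div_iff_forall_mul_mem]
    refine forall_congr' fun y => ?_
    refine imp_congr ?_ ?_
    · rw [Submodule.mem_traceDual]
      simp [Algebra.traceForm_apply, Submodule.mem_one, eq_comm]
    · rw [Submodule.mem_one]
  have aux : ∀ (σ : Gal(L/ℚ)) (x : 𝓞 L), x ∈ differentIdeal ℤ (𝓞 L) → 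
      σ • x ∈ differentIdeal ℤ (𝓞 L) := by
    intro σ x hx
    rw [key] at hx ⊢
    intro y hy
    obtain ⟨w, hw⟩ := hx (σ⁻¹ y) (fun z => by
      obtain ⟨n, hn⟩ := hy (σ • z)
      refine ⟨n, ?_⟩
      rw [← hn, ← Algebra.trace_eq_of_algEquiv σ]
      congr 1
      rw [map_mul]
      congr 1
      exact AlgEquiv.apply_symm_apply σ y)
    refine ⟨σ • w, ?_⟩
    change σ (w : L) = σ (x : L) * y
    rw [hw, map_mul]
    congr 1
    exact AlgEquiv.apply_symm_apply σ y
  ext x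
  rw [Ideal.mem_pointwise_smul_iff_inv_smul_mem]
  constructor
  · intro h
    simpa using aux σ _ h
  · exact aux _ _

theorem val_absNorm (M : Type) [Field M] [NumberField M] (p : ℕ) (hp : p.Prime)
    [Fintype ((Ideal.span {(p : ℤ)}).primesOver (𝓞 M))] (J : Ideal (𝓞 M)) (hJ : J ≠ ⊥) :
    padicValNat p (Ideal.absNorm J) =
      ∑ P : (Ideal.span {(p : ℤ)}).primesOver (𝓞 M),
        multiplicity P.1 J * P.1.inertiaDeg ℤ := by
  have : Fact p.Prime := ⟨hp⟩
  have hp0 : (Ideal.span {(p : ℤ)}) ≠ ⊥ := by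
    simpa using hp.ne_zero
  have hprime : ∀ P : (Ideal.span {(p : ℤ)}).primesOver (𝓞 M), Prime P.1 := fun P =>
    Ideal.prime_of_isPrime (Ideal.ne_bot_of_mem_primesOver hp0 P.2) P.2.1
  induction J using UniqueFactorizationMonoid.induction_on_prime with
  | h₁ => exact absurd rfl hJ
  | h₂ J hJu =>
    have h1 : J = ⊤ := by simpa using hJu
    subst h1
    rw [Ideal.absNorm_top, padicValNat_one_right]
    symm
    refine Finset.sum_eq_zero fun P _ => ?_
    rw [multiplicity_of_isUnit_right (hprime P).not_isUnit hJu, zero_mul]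
  | h₃ J Q hJ0 hQ IH =>
    have hJ0' : J ≠ ⊥ := hJ0
    have e1 : ∀ P : (Ideal.span {(p : ℤ)}).primesOver (𝓞 M),
        multiplicity P.1 (Q * J) * P.1.inertiaDeg ℤ =
          multiplicity P.1 Q * P.1.inertiaDeg ℤ + multiplicity P.1 J * P.1.inertiaDeg ℤ := by
      intro P
      rw [multiplicity_mul (hprime P) (FiniteMultiplicity.of_prime_left (hprime P) hJ), add_mul]
    rw [map_mul, padicValNat.mul (mt Ideal.absNorm_eq_zero_iff.mp hQ.ne_zero) (mt Ideal.absNorm_eq_zero_iff.mp hJ0'), IH hJ0',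
      Finset.sum_congr rfl (fun P _ => e1 P), Finset.sum_add_distrib]
    congr 1
    have hQp : Q.IsPrime := Ideal.isPrime_of_prime hQ
    have hne : ∀ P : (Ideal.span {(p : ℤ)}).primesOver (𝓞 M), P.1 ≠ Q → multiplicity P.1 Q = 0 :=
      fun P h => by
        rw [← emultiplicity_eq_zero_iff_multiplicity_eq_zero]
        exact emultiplicity_eq_zero_of_irreducible_ne (hprime P).irreducible hQ.irreducible h
    by_cases hQm : Q ∈ (Ideal.span {(p : ℤ)}).primesOver (𝓞 M)
    · rw [Finset.sum_eq_single (⟨Q, hQm⟩ : (Ideal.span {(p : ℤ)}).primesOver (𝓞 M))]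
      · have := hQm.2
        simp only [multiplicity_self, one_mul]
        rw [← Ideal.pow_inertiaDeg p Q, padicValNat.prime_pow]
      · intro P _ h
        rw [hne P (fun h' => h (Subtype.ext h')), zero_mul]
      · simp
    · rw [Finset.sum_eq_zero]
      · rw [padicValNat.eq_zero_iff]
        right; right
        intro hd
        obtain ⟨P, hP, h1, h2⟩ := Ideal.exists_isMaximal_dvd_of_dvd_absNorm' hp Q hd
        apply hQm
        have hPP : P ∈ (Ideal.span {(p : ℤ)}).primesOver (𝓞 M) := ⟨hP.isPrime, ⟨h1.symm⟩⟩
        by_contra hc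
        have := hne ⟨P, hPP⟩ (fun h => hQm (h ▸ hPP))
        exact (multiplicity_ne_zero.mpr h2) this
      · intro P _
        rw [hne P (fun h => hQm (h ▸ P.2)), zero_mul]

theorem mult_diff (K L : Type) [Field K] [NumberField K] [Field L] [NumberField L]
    [Algebra K L] (v : Ideal (𝓞 K)) (w : Ideal (𝓞 L))
    [v.IsPrime] [w.IsPrime] [w.LiesOver v] (hv : v ≠ ⊥) (hw : w ≠ ⊥) :
    multiplicity w (differentIdeal ℤ (𝓞 L)) =
      multiplicity w (differentIdeal (𝓞 K) (𝓞 L)) +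
        w.ramificationIdx (𝓞 K) * multiplicity v (differentIdeal ℤ (𝓞 K)) := by
  have hwp := Ideal.prime_of_isPrime hw inferInstance
  have hvp := Ideal.prime_of_isPrime hv inferInstance
  have hL : differentIdeal ℤ (𝓞 L) ≠ 0 := differentIdeal_ne_bot
  have hK : differentIdeal ℤ (𝓞 K) ≠ 0 := differentIdeal_ne_bot
  have h := differentIdeal_eq_differentIdeal_mul_differentIdeal ℤ (𝓞 K) (𝓞 L)
  have hf := FiniteMultiplicity.of_prime_left hwp hL
  rw [h] at hf
  rw [h, multiplicity_mul hwp hf]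
  congr 1
  have h3 := Ideal.IsDedekindDomain.emultiplicity_map_eq_ramificationIdx'_mul (S := 𝓞 L) hK hvp.irreducible hwp.irreducible hw
  rw [Ideal.ramificationIdx'_eq_ramificationIdx v w hv, hf.mul_right.emultiplicity_eq_multiplicity,
    (FiniteMultiplicity.of_prime_left hvp hK).emultiplicity_eq_multiplicity] at h3
  exact_mod_cast h3

theorem mult_diff_zero (A B : Type) [CommRing A] [CommRing B] [Algebra A B] 
    [IsDedekindDomain A] [IsDedekindDomain B] [Module.Finite ℤ A] [CharZero A] [CharZero B]
    [Module.Finite A B] [Module.IsTorsionFree A B] (w : Ideal B) [w.IsPrime]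
    (h : w.ramificationIdx A = 1) : multiplicity w (differentIdeal A B) = 0 := by
  rw [multiplicity_eq_zero, not_dvd_differentIdeal_iff, ← Ideal.ramificationIdx_eq_one_iff]
  exact h

theorem mult_diff_const (L : Type) [Field L] [NumberField L] [IsGalois ℚ L] 
  (hd : ∀ σ : Gal(L/ℚ), σ • differentIdeal ℤ (𝓞 L) = differentIdeal ℤ (𝓞 L)) (p : Ideal ℤ) (P Q : Ideal (𝓞 L))
  [P.IsPrime] [Q.IsPrime] [P.LiesOver p] [Q.LiesOver p] : 
  multiplicity P (differentIdeal ℤ (𝓞 L)) = multiplicity Q (differentIdeal ℤ (𝓞 L)) := by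
  obtain ⟨σ, rfl⟩ := Ideal.exists_smul_eq_of_isGaloisGroup p P Q Gal(L/ℚ)
  conv_rhs => rw [← hd σ]
  apply multiplicity_eq_of_emultiplicity_eq
  have key : ∀ (τ : Gal(L/ℚ)) (I J : Ideal (𝓞 L)), I ∣ J → τ • I ∣ τ • J := by
    rintro τ I J h
    rw [Ideal.dvd_iff_le] at h ⊢
    exact Ideal.pointwise_smul_le_pointwise_smul_iff.mpr h
  have pw : ∀ (τ : Gal(L/ℚ)) (I : Ideal (𝓞 L)) (n : ℕ), τ • (I ^ n) = (τ • I) ^ n := by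
    intro τ I n
    exact smul_pow' τ I n
  rw [emultiplicity_eq_emultiplicity_iff]
  intro n
  rw [← pw]
  refine ⟨key σ _ _, fun h => ?_⟩
  simpa using key σ⁻¹ _ _ h

theorem isGalois_of_inertia (K Kt : Type) [Field K] [NumberField K] [Field Kt] [NumberField Kt]
    [Algebra K Kt] [IsScalarTower ℚ K Kt]
    (hK3 : Module.finrank ℚ K = 3) [IsGalois ℚ Kt] (hKt6 : Module.finrank ℚ Kt = 6)
    (q : Ideal ℤ) 
    (h1 : ∀ P : Ideal (𝓞 Kt), P.IsPrime → P.LiesOver q →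
      Nat.card (P.inertia Gal(Kt/ℚ)) = 2)
    (h2 : ∀ P : Ideal (𝓞 Kt), P.IsPrime → P.LiesOver q → P.inertia Gal(Kt/K) = ⊤)
    (P : Ideal (𝓞 Kt)) [P.IsPrime] [P.LiesOver q] : IsGalois ℚ K := by
  let F : IntermediateField ℚ Kt := (IsScalarTower.toAlgHom ℚ K Kt).fieldRange
  let e : K ≃ₐ[ℚ] F := AlgEquiv.ofInjectiveField (IsScalarTower.toAlgHom ℚ K Kt)
  have hF : Module.finrank ℚ F = 3 := by rw [← hK3]; exact e.toLinearEquiv.finrank_eq.symm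
  have hcard : Nat.card F.fixingSubgroup = 2 := by
    rw [IsGalois.card_fixingSubgroup_eq_finrank]
    have := Module.finrank_mul_finrank ℚ F Kt
    rw [hF, hKt6] at this
    omega
  have hle : ∀ P : Ideal (𝓞 Kt), P.IsPrime → P.LiesOver q →
      F.fixingSubgroup = P.inertia Gal(Kt/ℚ) := by
    intro P hP hPq
    apply Subgroup.eq_of_le_of_card_ge
    · intro g hg
      rw [IntermediateField.mem_fixingSubgroup_iff] at hg
      let g' : Gal(Kt/K) := AlgEquiv.ofRingEquiv (f := g.toRingEquiv) (fun x => by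
        exact hg _ ⟨x, rfl⟩)
      have hg' : g' ∈ P.inertia Gal(Kt/K) := by rw [h2 P hP hPq]; trivial
      exact hg'
    · rw [h1 P hP hPq, hcard]
  have hn : F.fixingSubgroup.Normal := by
    constructor
    intro g hg τ
    rw [hle P inferInstance inferInstance]
    have hq' : (τ⁻¹ • P).LiesOver q := inferInstance
    rw [hle (τ⁻¹ • P) inferInstance inferInstance] at hg
    intro x
    have := hg (τ⁻¹ • x)
    have h3 := (Ideal.mem_inv_pointwise_smul_iff (a := τ)).mp this
    simpa [smul_sub, mul_smul] using h3
  have hG : IsGalois ℚ F := by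
    exact (InfiniteGalois.normal_iff_isGalois F).mp hn
  exact IsGalois.of_algEquiv e.symm

theorem totallyRamified_of_three_dvd (K : Type) [Field K] [NumberField K]
    (hK3 : Module.finrank ℚ K = 3) (p : ℕ) (hp : p.Prime)
    (v : Ideal (𝓞 K)) [v.IsPrime] [v.LiesOver (Ideal.span {(p : ℤ)})]
    (h : 3 ∣ v.ramificationIdx ℤ) : TotallyRamifiedAt p K := by
  have hp0 : (Ideal.span {(p : ℤ)}) ≠ ⊥ := by
    simpa using hp.ne_zero
  have hmap : (Ideal.span {(p : ℤ)}).map (algebraMap ℤ (𝓞 K)) = Ideal.span {(p : 𝓞 K)} := by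
    simp [Ideal.map_span]
  have hpos := Ideal.ramificationIdx_pos v ℤ
  rw [Ideal.IsDedekindDomain.ramificationIdx_eq_multiplicity (Ideal.span {(p : ℤ)}) v
    (by rw [hmap]; simpa using hp.ne_zero), hmap] at h hpos
  have h3 := Nat.le_of_dvd hpos h
  obtain ⟨J, hJ⟩ : v ^ 3 ∣ Ideal.span {(p : 𝓞 K)} :=
    (pow_dvd_pow v h3).trans (pow_multiplicity_dvd ..)
  refine ⟨v, inferInstance, ?_⟩
  have hN : Ideal.absNorm (Ideal.span {(p : 𝓞 K)}) = p ^ 3 := by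
    have := Ideal.absNorm_span_singleton (S := 𝓞 K) (p : 𝓞 K)
    rw [this]
    have h4 := Algebra.norm_algebraMap (S := 𝓞 K) (p : ℤ)
    rw [RingOfIntegers.rank, hK3] at h4
    simp only [algebraMap_int_eq, map_natCast] at h4
    rw [h4]
    simp [Int.natAbs_pow]
  have hv : Ideal.absNorm v = p ^ v.inertiaDeg ℤ := (Ideal.pow_inertiaDeg p v).symm
  have hf := Ideal.inertiaDeg_pos v ℤ
  have hN2 := congrArg Ideal.absNorm hJ
  rw [hN, map_mul, map_pow, hv, ← pow_mul] at hN2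
  obtain ⟨m, hm⟩ : p ^ 3 ∣ p ^ (v.inertiaDeg ℤ * 3) := pow_dvd_pow _ (by omega)
  rw [hm, mul_assoc] at hN2
  have h5 : m * Ideal.absNorm J = 1 :=
    (Nat.eq_of_mul_eq_mul_left (pow_pos hp.pos 3) (by rw [mul_one]; exact hN2)).symm
  have h6 : J = ⊤ := Ideal.absNorm_eq_one_iff.mp (Nat.eq_one_of_mul_eq_one_left h5)
  rw [hJ, h6, Ideal.mul_top]

theorem disc_valuation_not_totally_ramified
    (K Kt : Type) [Field K] [NumberField K] [Field Kt] [NumberField Kt]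
    [Algebra K Kt] [IsScalarTower ℚ K Kt]
    (hK3 : Module.finrank ℚ K = 3) (hKnotGal : ¬IsGalois ℚ K)
    (hGal : IsGalois ℚ Kt) (hKt6 : Module.finrank ℚ Kt = 6)
    (p : ℕ) (hp : p.Prime) (hram : ¬TotallyRamifiedAt p K) :
    padicValInt p (NumberField.discr Kt) = 3 * padicValInt p (NumberField.discr K) := by
  classical
  have hGK : IsGalois K Kt := IsGalois.tower_top_of_isGalois ℚ K Kt
  have hq0 : (Ideal.span {(p : ℤ)}) ≠ ⊥ := by
    simpa using hp.ne_zero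
  have hqp : (Ideal.span {(p : ℤ)}).IsPrime := by
    rw [Ideal.span_singleton_prime (by simpa using hp.ne_zero)]
    exact Nat.prime_iff_prime_int.mp hp
  have hqm : (Ideal.span {(p : ℤ)}).IsMaximal := Ideal.IsPrime.isMaximal hqp hq0
  set q : Ideal ℤ := Ideal.span {(p : ℤ)} with hq
  let _ : Fintype (q.primesOver (𝓞 Kt)) := (Algebra.QuasiFinite.finite_primesOver q).fintype
  let _ : Fintype (q.primesOver (𝓞 K)) := (Algebra.QuasiFinite.finite_primesOver q).fintype
  have h2 : Module.finrank K Kt = 2 := by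
    have := Module.finrank_mul_finrank ℚ K Kt
    rw [hK3, hKt6] at this
    omega
  unfold padicValInt
  rw [← absNorm_differentIdeal Kt (𝓞 Kt), ← absNorm_differentIdeal K (𝓞 K),
    val_absNorm Kt p hp _ differentIdeal_ne_bot, val_absNorm K p hp _ differentIdeal_ne_bot]
  have hsumL := Ideal.sum_ramification_inertia_eq_finrank q (𝓞 Kt)
  have hsumK := Ideal.sum_ramification_inertia_eq_finrank q (𝓞 K)
  rw [RingOfIntegers.rank] at hsumL hsumK
  rw [hKt6] at hsumL
  rw [hK3] at hsumK
  have hbotL : ∀ P : Ideal (𝓞 Kt), P.LiesOver q → P ≠ ⊥ := fun P hP =>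
    Ideal.ne_bot_of_liesOver_of_ne_bot hq0 P
  have hbotK : ∀ P : Ideal (𝓞 K), P.LiesOver q → P ≠ ⊥ := fun P hP =>
    Ideal.ne_bot_of_liesOver_of_ne_bot hq0 P
  -- ramification in Kt
  have hE : ∀ P : Ideal (𝓞 Kt), P.IsPrime → P.LiesOver q →
      P.ramificationIdx ℤ = q.ramificationIdxIn (𝓞 Kt) := fun P _ _ =>
    (Ideal.ramificationIdxIn_eq_ramificationIdx q P Gal(Kt/ℚ)).symm
  have hI : ∀ P : Ideal (𝓞 Kt), P.IsPrime → P.LiesOver q →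
      Nat.card (P.inertia Gal(Kt/ℚ)) = q.ramificationIdxIn (𝓞 Kt) := fun P _ _ =>
    Ideal.card_inertia_eq_ramificationIdxIn q P
  have hIK : ∀ P : Ideal (𝓞 Kt), P.IsPrime → P.LiesOver q →
      Nat.card (P.inertia Gal(Kt/K)) = P.ramificationIdx (𝓞 K) := fun P _ _ => by
    rw [Ideal.card_inertia_eq_ramificationIdxIn (P.under (𝓞 K)) P]
    exact Ideal.ramificationIdxIn_eq_ramificationIdx (P.under (𝓞 K)) P Gal(Kt/K)
  have hcardK : Nat.card Gal(Kt/K) = 2 := by rw [IsGalois.card_aut_eq_finrank, h2]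
  have hdvd2 : ∀ P : Ideal (𝓞 Kt), P.IsPrime → P.LiesOver q → P.ramificationIdx (𝓞 K) ∣ 2 :=
    fun P hP hPq => by
      rw [← hIK P hP hPq, ← hcardK]
      exact Subgroup.card_subgroup_dvd_card _
  have htower : ∀ (v : Ideal (𝓞 K)) (P : Ideal (𝓞 Kt)), P.LiesOver v → P.IsPrime → P.LiesOver q →
      v.ramificationIdx ℤ * P.ramificationIdx (𝓞 K) = q.ramificationIdxIn (𝓞 Kt) :=
    fun v P _ hP hPq => by
      rw [← hE P hP hPq]
      exact (Ideal.ramificationIdx_tower v P).symm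
  obtain ⟨P0, hP0, hP0q⟩ : Nonempty (q.primesOver (𝓞 Kt)) := inferInstance
  have hE6 : q.ramificationIdxIn (𝓞 Kt) ∣ 6 := by
    rw [← hI P0 hP0 hP0q, ← hKt6, ← IsGalois.card_aut_eq_finrank]
    exact Subgroup.card_subgroup_dvd_card _
  have hE3 : ¬ 3 ∣ q.ramificationIdxIn (𝓞 Kt) := by
    intro h3
    rw [← htower (P0.under (𝓞 K)) P0 inferInstance hP0 hP0q] at h3
    rcases (Nat.Prime.dvd_mul Nat.prime_three).mp h3 with h | h
    · exact hram (totallyRamified_of_three_dvd K hK3 p hp (P0.under (𝓞 K)) h)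
    · have := h.trans (hdvd2 P0 hP0 hP0q)
      omega
  -- constant multiplicity
  have hmL : ∀ P : Ideal (𝓞 Kt), P.IsPrime → P.LiesOver q →
      multiplicity P (differentIdeal ℤ (𝓞 Kt)) = multiplicity P0 (differentIdeal ℤ (𝓞 Kt)) :=
    fun P _ _ => mult_diff_const Kt (diff_smul Kt) q P P0
  set d := multiplicity P0 (differentIdeal ℤ (𝓞 Kt)) with hd
  -- primes of K have primes above
  have habove : ∀ v : Ideal (𝓞 K), v.IsPrime → v.LiesOver q →
      ∃ P : Ideal (𝓞 Kt), P.IsPrime ∧ P.LiesOver v ∧ P.LiesOver q := fun v hv hvq => by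
    obtain ⟨P, hP, hPv⟩ : Nonempty (v.primesOver (𝓞 Kt)) := inferInstance
    exact ⟨P, hP, hPv, Ideal.LiesOver.trans P v q⟩
  have hE12 : q.ramificationIdxIn (𝓞 Kt) = 1 ∨ q.ramificationIdxIn (𝓞 Kt) = 2 := by
    have := Nat.le_of_dvd (by norm_num) hE6
    interval_cases q.ramificationIdxIn (𝓞 Kt) <;> omega
  rcases hE12 with hE1 | hE2
  · rw [Finset.sum_eq_zero, Finset.sum_eq_zero]
    · simp
    · intro v _
      have := v.2.1
      have := v.2.2
      obtain ⟨P, hP, hPv, hPq⟩ := habove v.1 v.2.1 v.2.2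
      have h := htower v.1 P hPv hP hPq
      rw [hE1] at h
      rw [mult_diff_zero ℤ (𝓞 K) v.1 (Nat.eq_one_of_mul_eq_one_right h), zero_mul]
    · intro P _
      have := P.2.1
      rw [mult_diff_zero ℤ (𝓞 Kt) P.1 (by rw [hE P.1 P.2.1 P.2.2, hE1]), zero_mul]
  · have hL : ∑ P : q.primesOver (𝓞 Kt), P.1.inertiaDeg ℤ = 3 := by
      rw [Finset.sum_congr rfl (fun P _ => by rw [hE P.1 P.2.1 P.2.2, hE2]),
        ← Finset.mul_sum] at hsumL
      omega
    rw [Finset.sum_congr rfl (fun P _ => by rw [hmL P.1 P.2.1 P.2.2]), ← Finset.mul_sum, hL]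
    have hvK : ∀ v : q.primesOver (𝓞 K),
        (v.1.ramificationIdx ℤ = 1 ∧ multiplicity v.1 (differentIdeal ℤ (𝓞 K)) = 0) ∨
        (v.1.ramificationIdx ℤ = 2 ∧ multiplicity v.1 (differentIdeal ℤ (𝓞 K)) = d) := by
      intro v
      have hv1 := v.2.1
      have hv2 := v.2.2
      obtain ⟨P, hP, hPv, hPq⟩ := habove v.1 v.2.1 v.2.2
      have h := htower v.1 P hPv hP hPq
      rw [hE2] at h
      rcases (Nat.dvd_prime Nat.prime_two).mp (hdvd2 P hP hPq) with h' | h'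
      · right
        rw [h', mul_one] at h
        refine ⟨h, ?_⟩
        have hm := mult_diff K Kt v.1 P (hbotK _ hv2) (hbotL _ hPq)
        rw [hmL P hP hPq, mult_diff_zero (𝓞 K) (𝓞 Kt) P h', h', zero_add, one_mul] at hm
        exact hm.symm
      · left
        have h1 : v.1.ramificationIdx ℤ = 1 := by rw [h'] at h; omega
        exact ⟨h1, mult_diff_zero ℤ (𝓞 K) v.1 h1⟩
    have hm : ∀ v : q.primesOver (𝓞 K),
        multiplicity v.1 (differentIdeal ℤ (𝓞 K)) * v.1.inertiaDeg ℤ =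
          d * ((v.1.ramificationIdx ℤ - 1) * v.1.inertiaDeg ℤ) := by
      intro v
      rcases hvK v with ⟨h, h'⟩ | ⟨h, h'⟩ <;> simp [h, h']
    have hsplit : ∑ v : q.primesOver (𝓞 K), (v.1.ramificationIdx ℤ - 1) * v.1.inertiaDeg ℤ +
        ∑ v : q.primesOver (𝓞 K), v.1.inertiaDeg ℤ = 3 := by
      rw [← hsumK, ← Finset.sum_add_distrib]
      refine Finset.sum_congr rfl fun v _ => ?_
      rcases hvK v with ⟨h, h'⟩ | ⟨h, h'⟩ <;> rw [h] <;> ring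
    have hle : ∑ v : q.primesOver (𝓞 K), (v.1.ramificationIdx ℤ - 1) * v.1.inertiaDeg ℤ ≤
        ∑ v : q.primesOver (𝓞 K), v.1.inertiaDeg ℤ := by
      refine Finset.sum_le_sum fun v _ => ?_
      rcases hvK v with ⟨h, h'⟩ | ⟨h, h'⟩ <;> rw [h] <;> omega
    have hne : ∑ v : q.primesOver (𝓞 K), (v.1.ramificationIdx ℤ - 1) * v.1.inertiaDeg ℤ ≠ 0 := by
      intro h0
      rw [Finset.sum_eq_zero_iff] at h0
      apply hKnotGal
      refine isGalois_of_inertia K Kt hK3 hKt6 q (fun P hP hPq => by rw [hI P hP hPq, hE2])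
        (fun P hP hPq => ?_) P0
      apply Subgroup.eq_top_of_card_eq
      rw [hIK P hP hPq, hcardK]
      have hu : (P.under (𝓞 K)).LiesOver q := inferInstance
      have hz := h0 ⟨P.under (𝓞 K), inferInstance, hu⟩ (Finset.mem_univ _)
      have hpos := Ideal.inertiaDeg_pos (P.under (𝓞 K)) ℤ
      have ht := htower (P.under (𝓞 K)) P inferInstance hP hPq
      rcases hvK ⟨P.under (𝓞 K), inferInstance, hu⟩ with ⟨h, h'⟩ | ⟨h, h'⟩
      · simp only at h
        rw [h, hE2, one_mul] at ht
        exact ht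
      · simp only at h hz
        rw [h] at hz
        omega
    have h1 : ∑ v : q.primesOver (𝓞 K), (v.1.ramificationIdx ℤ - 1) * v.1.inertiaDeg ℤ = 1 := by
      omega
    rw [Finset.sum_congr rfl (fun v _ => hm v), ← Finset.mul_sum, h1]
    ring
end

section
/- Let K be a non-cyclic cubic field with Galois closure K̃, and suppose the prime 3 is totally ramified in K. Then v₃(Disc(K)) ∈ {3, 4, 5}, and v₃(Disc(K̃)) equals 7, 8, or 11 according as v₃(Disc(K)) equals 3, 4, or 5, where v₃ denotes the exponent of 3 in the discriminant of the ring of integers. -/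
open NumberField

lemma exists_moved_embedding {F K Kt : Type*} [Field F] [Field K] [Field Kt]
    [Algebra F K] [Algebra F Kt] [FiniteDimensional F Kt] 
    [Algebra K Kt] [FiniteDimensional K Kt] [IsScalarTower F K Kt]
    (hKnotGal : ¬IsGalois F K) (hGal : IsGalois F Kt) (h2 : Module.finrank K Kt = 2) :
    ∃ (τ : Kt ≃ₐ[K] Kt) (φ : K →ₐ[F] Kt),
      (∀ x, τ (τ x) = x) ∧ ∃ x, τ (φ x) ≠ φ x := by
  have : IsGalois K Kt := IsGalois.tower_top_of_isGalois F K Kt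
  have hcard : Nat.card (Kt ≃ₐ[K] Kt) = 2 := by rw [IsGalois.card_aut_eq_finrank, h2]
  obtain ⟨τ, hτ, hall⟩ := (Nat.card_eq_two_iff' (1 : Kt ≃ₐ[K] Kt)).mp hcard
  have hττ : τ * τ = 1 := by
    by_contra h
    have h3 := hall _ h
    exact hτ (mul_eq_left.mp h3)
  by_contra hcon
  push Not at hcon
  have key : ∀ (φ : K →ₐ[F] Kt) (x : K), τ (φ x) = φ x := fun φ x =>
    hcon τ φ (fun y => by rw [← AlgEquiv.mul_apply, hττ]; rfl) x
  apply hKnotGal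
  let i : K →ₐ[F] Kt := IsScalarTower.toAlgHom F K Kt
  have hn : Normal F i.fieldRange := by
    rw [IntermediateField.normal_iff_forall_map_le']
    rintro σ y ⟨z, ⟨x, rfl⟩, rfl⟩
    have hfix : ∀ f : Kt ≃ₐ[K] Kt, f (σ (i x)) = σ (i x) := by
      intro f
      by_cases hf : f = 1
      · rw [hf]; rfl
      · rw [hall f hf]
        exact key ((σ : Kt →ₐ[F] Kt).comp i) x
    have := (IsGalois.mem_bot_iff_fixed (F := K) (E := Kt) (σ (i x))).mpr hfix
    obtain ⟨w, hw⟩ := IntermediateField.mem_bot.mp this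
    exact ⟨w, hw⟩
  have : Algebra.IsSeparable F K := Algebra.isSeparable_tower_bot_of_isSeparable F K Kt
  have : Normal F K := Normal.of_algEquiv (h := hn) (show i.fieldRange ≃ₐ[F] K from (AlgEquiv.ofInjectiveField i).symm)
  exact ⟨⟩

lemma exists_sqrt_discr (K Kt : Type) [Field K] [NumberField K] [Field Kt] [NumberField Kt]
    [Algebra K Kt] [IsScalarTower ℚ K Kt]
    (hK3 : Module.finrank ℚ K = 3) (hKnotGal : ¬IsGalois ℚ K) (hGal : IsGalois ℚ Kt)
    (h2 : Module.finrank K Kt = 2) :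
    ∃ δ : Kt, δ ^ 2 = (discr K : Kt) ∧ δ ≠ 0 ∧ ∃ τ : Kt ≃ₐ[K] Kt, τ δ = -δ := by
  classical
  obtain ⟨τ, φ, hττ, x, hx⟩ := exists_moved_embedding (F := ℚ) hKnotGal hGal h2
  let φ0 : K →ₐ[ℚ] Kt := IsScalarTower.toAlgHom ℚ K Kt
  let φ2 : K →ₐ[ℚ] Kt := ((τ.restrictScalars ℚ : Kt ≃ₐ[ℚ] Kt) : Kt →ₐ[ℚ] Kt).comp φ
  have e0 : ∀ y, τ (φ0 y) = φ0 y := fun y => τ.commutes y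
  have e1 : ∀ y, τ (φ y) = φ2 y := fun y => rfl
  have e2 : ∀ y, τ (φ2 y) = φ y := fun y => hττ _
  have n01 : φ0 ≠ φ := by
    rintro h; apply hx; rw [← h]; exact e0 x
  have n12 : φ ≠ φ2 := by
    intro h; apply hx; rw [e1, ← h]
  have n02 : φ0 ≠ φ2 := by
    intro h; apply n01; ext y
    rw [← e2, ← h, e0]
  let E := AlgebraicClosure Kt
  let j : Kt →ₐ[ℚ] E := IsScalarTower.toAlgHom ℚ Kt E
  have hj : Function.Injective j := j.toRingHom.injective
  let Φ : Fin 3 → (K →ₐ[ℚ] Kt) := ![φ0, φ, φ2]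
  have hΦ : Function.Injective Φ := by
    intro a b hab
    fin_cases a <;> fin_cases b <;> simp [Φ] at hab ⊢
    · exact n01 hab
    · exact n02 hab
    · exact n01 hab.symm
    · exact n12 hab
    · exact n02 hab.symm
    · exact n12 hab.symm
  have hinj : Function.Injective (fun a => j.comp (Φ a)) := by
    intro a b hab
    apply hΦ
    ext y
    apply hj
    exact DFunLike.congr_fun hab y
  have hbij : Function.Bijective (fun a => j.comp (Φ a)) := by
    rw [Fintype.bijective_iff_injective_and_card]
    refine ⟨hinj, ?_⟩
    rw [AlgHom.card ℚ K E, hK3]; simp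
  let e := Equiv.ofBijective _ hbij
  have hci : Fintype.card (Module.Free.ChooseBasisIndex ℤ (𝓞 K)) = 3 := by
    rw [← Module.finrank_eq_card_basis (integralBasis K), hK3]
  let r := Fintype.equivFinOfCardEq hci
  let b := (integralBasis K).reindex r
  have hd : Algebra.discr ℚ b = (discr K : ℚ) := by
    rw [coe_discr]
    simp only [b]
    rw [Module.Basis.coe_reindex]
    exact Algebra.discr_reindex ℚ (integralBasis K) r
  have hsq := Algebra.discr_eq_det_embeddingsMatrixReindex_pow_two ℚ E b e
  let M : Matrix (Fin 3) (Fin 3) Kt := Matrix.of fun i k => Φ k (b i)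
  have hM : Algebra.embeddingsMatrixReindex ℚ E b e = j.toRingHom.mapMatrix M := by
    ext i k
    rfl
  rw [hM, ← RingHom.map_det, hd] at hsq
  have hsq' : M.det ^ 2 = (discr K : Kt) := by
    apply hj
    have : j (M.det ^ 2) = j.toRingHom M.det ^ 2 := by simp
    rw [this, ← hsq]
    simp
  refine ⟨M.det, hsq', ?_, τ, ?_⟩
  · intro h
    rw [h] at hsq'
    have : (discr K : Kt) ≠ 0 := by exact_mod_cast discr_ne_zero K
    apply this; rw [← hsq']; ring
  · rw [Matrix.det_fin_three]
    simp only [M, Φ, Matrix.of_apply, Matrix.cons_val_zero, Matrix.cons_val_one, Matrix.cons_val,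
      map_sub, map_add, map_mul, e0, e1, e2]
    ring

lemma absNorm_of_totallyRam (K : Type) [Field K] [NumberField K]
    (hK3 : Module.finrank ℚ K = 3) (P : Ideal (𝓞 K)) 
    (h : Ideal.span {((3 : ℕ) : 𝓞 K)} = P ^ 3) : Ideal.absNorm P = 3 := by
  have h1 := congrArg Ideal.absNorm h
  rw [map_pow, Ideal.absNorm_span_singleton] at h1
  have h2 : Algebra.norm ℤ ((3 : ℕ) : 𝓞 K) = 27 := by
    have := Algebra.norm_algebraMap (S := 𝓞 K) (3 : ℤ)
    rw [RingOfIntegers.rank, hK3] at this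
    simpa using this
  rw [h2] at h1
  have h3 : (Ideal.absNorm P) ^ 3 = 3 ^ 3 := by rw [← h1]; rfl
  exact Nat.pow_left_injective (by norm_num : 3 ≠ 0) h3

lemma dvd_of_three_dvd_absNorm (K : Type) [Field K] [NumberField K]
    (P : Ideal (𝓞 K)) (hP : P.IsPrime)
    (h : Ideal.span {((3 : ℕ) : 𝓞 K)} = P ^ 3) (J : Ideal (𝓞 K)) (hJ : 3 ∣ Ideal.absNorm J) :
    P ∣ J := by
  obtain ⟨Q, hQ, hu, hd⟩ := Ideal.exists_isMaximal_dvd_of_dvd_absNorm' Nat.prime_three J hJ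
  have h3 : ((3 : ℕ) : 𝓞 K) ∈ Q := by
    have : ((3 : ℕ) : ℤ) ∈ Q.under ℤ := by rw [hu]; exact Ideal.mem_span_singleton_self _
    simpa [Ideal.under_def] using this
  have hle : P ^ 3 ≤ Q := by
    rw [← h, Ideal.span_singleton_le_iff_mem]; exact h3
  have hPQ : P ≤ Q := hQ.isPrime.le_of_pow_le hle
  have hPbot : P ≠ ⊥ := by
    rintro rfl
    rw [← Ideal.zero_eq_bot, zero_pow (by norm_num), Ideal.zero_eq_bot,
      Ideal.span_singleton_eq_bot] at h
    norm_num at h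
  have := (hP.isMaximal hPbot).eq_of_le hQ.ne_top hPQ
  rwa [this]

lemma padic_absNorm_eq (K : Type) [Field K] [NumberField K]
    (hK3 : Module.finrank ℚ K = 3) (P : Ideal (𝓞 K)) (hP : P.IsPrime)
    (h : Ideal.span {((3 : ℕ) : 𝓞 K)} = P ^ 3) (J : Ideal (𝓞 K)) (n : ℕ)
    (h1 : P ^ n ∣ J) (h2 : ¬ P ^ (n + 1) ∣ J) : padicValNat 3 (Ideal.absNorm J) = n := by
  obtain ⟨I, rfl⟩ := h1
  have h3 : ¬ 3 ∣ Ideal.absNorm I := by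
    intro hd
    apply h2
    rw [pow_succ]
    exact mul_dvd_mul_left _ (dvd_of_three_dvd_absNorm K P hP h I hd)
  rw [map_mul, map_pow, absNorm_of_totallyRam K hK3 P h]
  have : Fact (Nat.Prime 3) := ⟨Nat.prime_three⟩
  rw [padicValNat.mul (by norm_num) (by intro h0; rw [h0] at h3; simp at h3),
    padicValNat.prime_pow, padicValNat.eq_zero_of_not_dvd h3, add_zero]

lemma three_dvd_trace (K : Type) [Field K] [NumberField K]
    (hK3 : Module.finrank ℚ K = 3) (P : Ideal (𝓞 K)) 
    (h : Ideal.span {((3 : ℕ) : 𝓞 K)} = P ^ 3) (x : 𝓞 K) :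
    (3 : ℤ) ∣ Algebra.trace ℤ (𝓞 K) x := by
  have hN := absNorm_of_totallyRam K hK3 P h
  have hfact : Fact (Nat.Prime 3) := ⟨Nat.prime_three⟩
  have hcard : Nat.card (𝓞 K ⧸ P) = 3 := hN
  have hne : P ≠ ⊤ := by rintro rfl; simp at hN
  have : Nontrivial (𝓞 K ⧸ P) := Ideal.Quotient.nontrivial_iff.mpr hne
  have hz : AddSubgroup.zmultiples (1 : 𝓞 K ⧸ P) = ⊤ :=
    zmultiples_eq_top_of_prime_card hcard one_ne_zero
  obtain ⟨m, hm⟩ : (Ideal.Quotient.mk P x) ∈ AddSubgroup.zmultiples (1 : 𝓞 K ⧸ P) := by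
    rw [hz]; trivial
  have hy : x - (m : 𝓞 K) ∈ P := by
    rw [← Ideal.Quotient.eq_zero_iff_mem, map_sub, ← hm]
    simp
  have hmax : (Ideal.span {(3 : ℤ)}).IsMaximal :=
    ((Ideal.span_singleton_prime (by norm_num)).mpr Int.prime_three).isMaximal
      (by simp)
  have hty : (3 : ℤ) ∣ Algebra.trace ℤ (𝓞 K) (x - (m : 𝓞 K)) := by
    rw [← Ideal.mem_span_singleton, ← Algebra.intTrace_eq_trace ℤ, ← Ideal.Quotient.eq_zero_iff_mem,
      ← Algebra.trace_quotient_eq_of_isDedekindDomain, ← isNilpotent_iff_eq_zero]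
    refine Algebra.isNilpotent_trace_of_isNilpotent ⟨3, ?_⟩
    rw [← map_pow, Ideal.Quotient.eq_zero_iff_mem, Ideal.map_span, Set.image_singleton]
    have := Ideal.pow_mem_pow hy 3
    rw [← h] at this
    simpa using this
  have htm : (3 : ℤ) ∣ Algebra.trace ℤ (𝓞 K) (m : 𝓞 K) := by
    have := Algebra.trace_algebraMap (R := ℤ) (S := 𝓞 K) m
    rw [RingOfIntegers.rank, hK3] at this
    simp at this
    exact ⟨m, by simpa using this⟩
  have := dvd_add hty htm
  rwa [← map_add, sub_add_cancel] at this

lemma three_dvd_different (K : Type) [Field K] [NumberField K]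
    (hK3 : Module.finrank ℚ K = 3) (P : Ideal (𝓞 K)) 
    (h : Ideal.span {((3 : ℕ) : 𝓞 K)} = P ^ 3) :
    P ^ 3 ∣ differentIdeal ℤ (𝓞 K) := by
  rw [← h, Ideal.dvd_iff_le, differentialIdeal_le_iff (K := ℚ) (L := K) (by simp)]
  rw [Submodule.map_le_iff_le_comap]
  intro y hy
  rw [Submodule.restrictScalars_mem, FractionalIdeal.mem_coe,
    FractionalIdeal.mem_inv_iff
      (by rw [ne_eq, FractionalIdeal.coeIdeal_eq_zero]; simp)] at hy
  obtain ⟨z, hz⟩ := (FractionalIdeal.mem_one_iff _).mp (hy 3 ((FractionalIdeal.mem_coeIdeal _).mpr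
    ⟨((3 : ℕ) : 𝓞 K), Ideal.mem_span_singleton_self _, map_natCast (algebraMap (𝓞 K) K) 3⟩))
  rw [Submodule.mem_comap, LinearMap.coe_restrictScalars]
  obtain ⟨t, ht⟩ := three_dvd_trace K hK3 P h z
  rw [Submodule.mem_one]
  refine ⟨t, ?_⟩
  have h1 : Algebra.trace ℚ K (algebraMap (𝓞 K) K z) = algebraMap ℤ ℚ (Algebra.trace ℤ (𝓞 K) z) := by
    rw [← Algebra.intTrace_eq_trace ℤ, Algebra.algebraMap_intTrace (A := ℤ) (K := ℚ) (L := K)]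
  rw [hz, ht] at h1
  have h2 : y * 3 = (3 : ℚ) • y := by rw [Algebra.smul_def]; simp [mul_comm]
  rw [h2, map_smul] at h1
  simp at h1 ⊢
  linarith

lemma not_nine_dvd_different (K : Type) [Field K] [NumberField K]
    (hK3 : Module.finrank ℚ K = 3) (P : Ideal (𝓞 K)) 
    (h : Ideal.span {((3 : ℕ) : 𝓞 K)} = P ^ 3) :
    ¬ P ^ 6 ∣ differentIdeal ℤ (𝓞 K) := by
  have h6 : P ^ 6 = Ideal.map (algebraMap ℤ (𝓞 K)) (Ideal.span {9}) := by
    rw [show 6 = 3 * 2 by norm_num, pow_mul, ← h, Ideal.span_singleton_pow, Ideal.map_span,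
      Set.image_singleton]
    norm_num
  refine not_dvd_differentIdeal_of_intTrace_not_mem (p := Ideal.span {(9 : ℤ)}) ℤ (P ^ 6) ⊤
    (by rw [Ideal.mul_top, h6]) 1 trivial ?_
  have := Algebra.trace_algebraMap (R := ℤ) (S := 𝓞 K) 1
  rw [RingOfIntegers.rank, hK3, map_one] at this
  rw [Algebra.intTrace_eq_trace, this, Ideal.mem_span_singleton]
  norm_num

lemma val_discr (K : Type) [Field K] [NumberField K]
    (hK3 : Module.finrank ℚ K = 3) (P : Ideal (𝓞 K)) (hP : P.IsPrime)
    (h : Ideal.span {((3 : ℕ) : 𝓞 K)} = P ^ 3) :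
    padicValInt 3 (discr K) = 3 ∨ padicValInt 3 (discr K) = 4 ∨ padicValInt 3 (discr K) = 5 := by
  have h3 := three_dvd_different K hK3 P h
  have h6 := not_nine_dvd_different K hK3 P h
  have key := padic_absNorm_eq K hK3 P hP h (differentIdeal ℤ (𝓞 K))
  rw [absNorm_differentIdeal K] at key
  unfold padicValInt
  by_cases h4 : P ^ 4 ∣ differentIdeal ℤ (𝓞 K)
  · by_cases h5 : P ^ 5 ∣ differentIdeal ℤ (𝓞 K)
    · exact Or.inr (Or.inr (key 5 h5 h6))
    · exact Or.inr (Or.inl (key 4 h4 h5))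
  · exact Or.inl (key 3 h3 h4)

lemma two_mul_mem_different (K Kt : Type) [Field K] [NumberField K] [Field Kt] [NumberField Kt]
    [Algebra K Kt] (h2 : Module.finrank K Kt = 2) (τ : Kt ≃ₐ[K] Kt) (γ : 𝓞 Kt) (c : 𝓞 K)
    (hγ0 : γ ≠ 0)
    (hτ : τ (γ : Kt) = -(γ : Kt)) (hc : γ ^ 2 = algebraMap (𝓞 K) (𝓞 Kt) c) :
    2 * γ ∈ differentIdeal (𝓞 K) (𝓞 Kt) := by
  have hγ0' : (γ : Kt) ≠ 0 := by simpa using hγ0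
  have hnot : (γ : Kt) ∉ (⊥ : IntermediateField K Kt) := by
    intro h
    obtain ⟨w, hw⟩ := IntermediateField.mem_bot.mp h
    rw [← hw, τ.commutes] at hτ
    apply hγ0'
    rw [← hw]
    exact self_eq_neg.mp hτ
  have hint : IsIntegral K (γ : Kt) := Algebra.IsIntegral.isIntegral _
  have htop : IntermediateField.adjoin K {(γ : Kt)} = ⊤ := by
    have := IntermediateField.isSimpleOrder_of_finrank_prime K Kt (by rw [h2]; exact Nat.prime_two)
    rcases eq_bot_or_eq_top (IntermediateField.adjoin K {(γ : Kt)}) with h | h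
    · exact absurd (h ▸ IntermediateField.mem_adjoin_simple_self K _) hnot
    · exact h
  have htop' : Algebra.adjoin K {algebraMap (𝓞 Kt) Kt γ} = ⊤ := by
    rw [← IntermediateField.adjoin_simple_toSubalgebra_of_isAlgebraic hint.isAlgebraic, htop]
    rfl
  have hdeg : (minpoly K (γ : Kt)).natDegree = 2 := by
    rw [← IntermediateField.adjoin.finrank hint, htop, IntermediateField.finrank_top', h2]
  have hint' : IsIntegral (𝓞 K) γ := Algebra.IsIntegral.isIntegral _
  have hmp : minpoly (𝓞 K) γ = Polynomial.X ^ 2 - Polynomial.C c := by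
    symm
    apply Polynomial.eq_of_monic_of_dvd_of_natDegree_le (minpoly.monic hint')
      (Polynomial.monic_X_pow_sub_C c two_ne_zero)
    · apply minpoly.isIntegrallyClosed_dvd hint'
      simp [hc]
    · rw [Polynomial.natDegree_X_pow_sub_C]
      have := minpoly.isIntegrallyClosed_eq_field_fractions K Kt hint'
      rw [← hdeg, show (γ : Kt) = algebraMap (𝓞 Kt) Kt γ from rfl, this,
        (minpoly.monic hint').natDegree_map]
  have := aeval_derivative_mem_differentIdeal (𝓞 K) K Kt γ htop'
  rw [hmp] at this
  have e2 : (algebraMap (𝓞 K) (𝓞 Kt)) 2 = 2 := map_ofNat _ 2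
  simpa [one_add_one_eq_two, e2] using this

lemma absNorm_sq_eq (K Kt : Type) [Field K] [NumberField K] [Field Kt] [NumberField Kt]
    [Algebra K Kt] (h2 : Module.finrank K Kt = 2) (γ : 𝓞 Kt) (c : 𝓞 K)
    (hc : γ ^ 2 = algebraMap (𝓞 K) (𝓞 Kt) c) :
    Ideal.absNorm (Ideal.span {γ}) = Ideal.absNorm (Ideal.span {c}) := by
  have h1 : Ideal.span {γ} ^ 2 = (Ideal.span {c}).map (algebraMap (𝓞 K) (𝓞 Kt)) := by
    rw [Ideal.span_singleton_pow, hc, Ideal.map_span, Set.image_singleton]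
  have h3 := congrArg Ideal.absNorm h1
  rw [map_pow, Ideal.absNorm_algebraMap, ← IsFractionRing.finrank_eq (𝓞 K) K (𝓞 Kt) Kt, h2] at h3
  exact Nat.pow_left_injective two_ne_zero h3

lemma absNorm_intCast (K : Type) [Field K] [NumberField K] (hK3 : Module.finrank ℚ K = 3) (m : ℤ) :
    Ideal.absNorm (Ideal.span {(m : 𝓞 K)}) = m.natAbs ^ 3 := by
  have := Algebra.norm_algebraMap (S := 𝓞 K) m
  rw [RingOfIntegers.rank, hK3] at this
  rw [Ideal.absNorm_span_singleton, show (m : 𝓞 K) = algebraMap ℤ (𝓞 K) m by simp, this,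
    Int.natAbs_pow]

lemma val_discr_tower (K Kt : Type) [Field K] [NumberField K] [Field Kt] [NumberField Kt]
    [Algebra K Kt] (h2 : Module.finrank K Kt = 2) :
    padicValInt 3 (discr Kt) = 2 * padicValInt 3 (discr K) +
      padicValNat 3 (Ideal.absNorm (differentIdeal (𝓞 K) (𝓞 Kt))) := by
  have := natAbs_discr_eq_absNorm_differentIdeal_mul_natAbs_discr_pow K (𝓞 K) Kt (𝓞 Kt)
  have hf : Fact (Nat.Prime 3) := ⟨Nat.prime_three⟩
  have h0 : (discr Kt).natAbs ≠ 0 := by simpa using discr_ne_zero Kt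
  have h1 : (discr K).natAbs ≠ 0 := by simpa using discr_ne_zero K
  unfold padicValInt
  rw [this] at h0
  rw [this, padicValNat.mul (left_ne_zero_of_mul h0) (right_ne_zero_of_mul h0), h2,
    padicValNat.pow]
  ring

lemma different_val_even (K Kt : Type) [Field K] [NumberField K] [Field Kt] [NumberField Kt]
    [Algebra K Kt] (hK3 : Module.finrank ℚ K = 3) (h2 : Module.finrank K Kt = 2)
    (τ : Kt ≃ₐ[K] Kt) (δ : Kt) (hδ0 : δ ≠ 0) (hτ : τ δ = -δ) (m : ℤ) (hm : ¬ (3 : ℤ) ∣ m)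
    (hδ : δ ^ 2 = ((81 * m : ℤ) : Kt)) :
    padicValNat 3 (Ideal.absNorm (differentIdeal (𝓞 K) (𝓞 Kt))) = 0 := by
  have hsq : (δ / 9) ^ 2 = (m : Kt) := by
    rw [div_pow, hδ]; push_cast; norm_num
  have hint : IsIntegral ℤ (δ / 9) := by
    apply IsIntegral.of_pow (n := 2) two_pos
    rw [hsq]
    exact isIntegral_algebraMap (R := ℤ) (x := m)
  let γ : 𝓞 Kt := ⟨δ / 9, hint⟩
  have hγK : (γ : Kt) = δ / 9 := rfl
  have hγ : γ ^ 2 = algebraMap (𝓞 K) (𝓞 Kt) (m : 𝓞 K) := by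
    apply RingOfIntegers.ext
    simp [hγK, hsq]
  have hγ0 : γ ≠ 0 := by
    intro h
    have : (γ : Kt) = 0 := by rw [h]; simp
    rw [hγK] at this
    exact hδ0 (by simpa using this)
  have hmem := two_mul_mem_different K Kt h2 τ γ (m : 𝓞 K) hγ0
    (by rw [hγK, map_div₀, hτ, map_ofNat, neg_div]) hγ
  have hN : Ideal.absNorm (Ideal.span {2 * γ}) = (4 * m).natAbs ^ 3 := by
    rw [absNorm_sq_eq K Kt h2 (2 * γ) ((4 * m : ℤ) : 𝓞 K), absNorm_intCast K hK3]
    have e4 : (algebraMap (𝓞 K) (𝓞 Kt)) ((4 : ℤ) : 𝓞 K) = 4 := by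
      rw [map_intCast]; norm_num
    rw [mul_pow, hγ, Int.cast_mul, map_mul, e4]
    norm_num
  apply padicValNat.eq_zero_of_not_dvd
  intro h3
  have hd : Ideal.absNorm (differentIdeal (𝓞 K) (𝓞 Kt)) ∣ Ideal.absNorm (Ideal.span {2 * γ}) :=
    map_dvd _ (Ideal.dvd_span_singleton.mpr hmem)
  rw [hN] at hd
  have h4 := Nat.prime_three.dvd_of_dvd_pow (h3.trans hd)
  have h5 : (3 : ℤ) ∣ 4 * m := Int.natCast_dvd.mpr h4
  omega

lemma different_val_odd (K Kt : Type) [Field K] [NumberField K] [Field Kt] [NumberField Kt]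
    [Algebra K Kt] (hK3 : Module.finrank ℚ K = 3) (h2 : Module.finrank K Kt = 2)
    (P : Ideal (𝓞 K)) (hP : P.IsPrime) (h : Ideal.span {((3 : ℕ) : 𝓞 K)} = P ^ 3)
    (τ : Kt ≃ₐ[K] Kt) (δ : Kt) (hδ0 : δ ≠ 0) (hτ : τ δ = -δ) (m : ℤ) (hm : ¬ (3 : ℤ) ∣ m) (k : ℕ)
    (hδ : δ ^ 2 = ((3 ^ (2 * k + 1) * m : ℤ) : Kt)) :
    padicValNat 3 (Ideal.absNorm (differentIdeal (𝓞 K) (𝓞 Kt))) = 1 := by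
  have hf : Fact (Nat.Prime 3) := ⟨Nat.prime_three⟩
  have hNP := absNorm_of_totallyRam K hK3 P h
  have hPbot : P ≠ ⊥ := by rintro rfl; simp at hNP
  have hPmax : P.IsMaximal := hP.isMaximal hPbot
  obtain ⟨π, hπ1, hπ2⟩ : ∃ π ∈ P, π ∉ P ^ 2 := by
    have hlt : P ^ 2 < P := by
      simpa using Ideal.pow_right_strictAnti P hPbot hP.ne_top (show 1 < 2 by norm_num)
    obtain ⟨x, hx, hx'⟩ := SetLike.exists_of_lt hlt
    exact ⟨x, hx, hx'⟩
  have hvπ : padicValNat 3 (Ideal.absNorm (Ideal.span {π})) = 1 := by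
    apply padic_absNorm_eq K hK3 P hP h
    · rw [pow_one]; exact Ideal.dvd_span_singleton.mpr hπ1
    · intro hd; exact hπ2 (Ideal.dvd_span_singleton.mp hd)
  have hπ0 : π ≠ 0 := by rintro rfl; exact hπ2 (zero_mem _)
  obtain ⟨u, hu⟩ : ∃ u, π ^ 4 = 3 * u := by
    have : π ^ 4 ∈ P ^ 3 := Ideal.pow_le_pow_right (by norm_num) (Ideal.pow_mem_pow hπ1 4)
    rw [← h, Ideal.mem_span_singleton] at this
    simpa [dvd_def] using this
  have hu0 : u ≠ 0 := by
    rintro rfl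
    rw [mul_zero] at hu
    exact hπ0 (by simpa using hu)
  have hm0 : m ≠ 0 := by rintro rfl; simp at hm
  have hNu : Ideal.absNorm (Ideal.span {u}) ≠ 0 := by simpa [Ideal.absNorm_eq_zero_iff] using hu0
  have hvu : padicValNat 3 (Ideal.absNorm (Ideal.span {u})) = 1 := by
    have h1 : Ideal.span {π} ^ 4 = Ideal.span {((3 : ℤ) : 𝓞 K)} * Ideal.span {u} := by
      rw [Ideal.span_singleton_pow, hu, Ideal.span_singleton_mul_span_singleton]
      norm_num
    have h3 := congrArg (fun I => padicValNat 3 (Ideal.absNorm I)) h1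
    simp only [map_pow, map_mul] at h3
    rw [absNorm_intCast K hK3, padicValNat.mul (by norm_num) hNu, padicValNat.pow, hvπ] at h3
    rw [show (3 : ℤ).natAbs ^ 3 = 3 ^ 3 by rfl, padicValNat.prime_pow] at h3
    omega
  have hNm : ¬ 3 ∣ m.natAbs := by
    intro h3; exact hm (Int.natCast_dvd.mpr h3)
  let b : 𝓞 K := (m : 𝓞 K) * u
  have hb0 : b ≠ 0 := mul_ne_zero (by exact_mod_cast hm0) hu0
  have hvb : padicValNat 3 (Ideal.absNorm (Ideal.span {b})) = 1 := by
    simp only [b]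
    rw [← Ideal.span_singleton_mul_span_singleton, map_mul, absNorm_intCast K hK3,
      padicValNat.mul (by simpa using hm0) hNu, hvu, padicValNat.pow,
      padicValNat.eq_zero_of_not_dvd hNm]
  -- the element β
  let p' : Kt := algebraMap K Kt (π : K)
  have hp4 : p' ^ 4 = 3 * algebraMap K Kt (u : K) := by
    have := congrArg (fun z : 𝓞 K => algebraMap K Kt (z : K)) hu
    have e3 : (algebraMap (𝓞 K) K) 3 = 3 := map_ofNat _ 3
    simp only [map_pow, map_mul, e3] at this
    rw [map_ofNat] at this
    exact this
  have hsq : (δ * p' ^ 2 / 3 ^ (k + 1)) ^ 2 = algebraMap K Kt (b : K) := by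
    have e1 : (δ * p' ^ 2 / 3 ^ (k + 1)) ^ 2 = δ ^ 2 * p' ^ 4 / 3 ^ (2 * k + 2) := by
      rw [div_pow]; ring
    rw [e1, hδ, hp4]
    simp only [b]
    push_cast
    rw [div_eq_iff (pow_ne_zero _ three_ne_zero)]
    simp
    ring
  have hint : IsIntegral ℤ (δ * p' ^ 2 / 3 ^ (k + 1)) := by
    apply IsIntegral.of_pow (n := 2) two_pos
    rw [hsq]
    exact (RingOfIntegers.isIntegral_coe b).algebraMap
  let γ : 𝓞 Kt := ⟨δ * p' ^ 2 / 3 ^ (k + 1), hint⟩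
  have hγK : (γ : Kt) = δ * p' ^ 2 / 3 ^ (k + 1) := rfl
  have hγ : γ ^ 2 = algebraMap (𝓞 K) (𝓞 Kt) b := by
    apply RingOfIntegers.ext
    exact hsq
  have hγ0 : γ ≠ 0 := by
    intro h0
    rw [h0] at hγ
    apply hb0
    apply FaithfulSMul.algebraMap_injective (𝓞 K) (𝓞 Kt)
    rw [← hγ]; simp
  have hτp : τ p' = p' := τ.commutes _
  have hmem := two_mul_mem_different K Kt h2 τ γ b hγ0
    (by rw [hγK, map_div₀, map_mul, map_pow, map_pow, hτ, hτp, map_ofNat]; ring) hγ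
  have hN : Ideal.absNorm (Ideal.span {2 * γ}) = 4 ^ 3 * Ideal.absNorm (Ideal.span {b}) := by
    rw [absNorm_sq_eq K Kt h2 (2 * γ) (((4 : ℤ) : 𝓞 K) * b),
      ← Ideal.span_singleton_mul_span_singleton, map_mul, absNorm_intCast K hK3]
    · rfl
    · have e4 : (algebraMap (𝓞 K) (𝓞 Kt)) ((4 : ℤ) : 𝓞 K) = 4 := by
        rw [map_intCast]; norm_num
      rw [mul_pow, hγ, map_mul (algebraMap (𝓞 K) (𝓞 Kt)) _ b, e4]
      norm_num
  have hNb : Ideal.absNorm (Ideal.span {b}) ≠ 0 := by simpa [Ideal.absNorm_eq_zero_iff] using hb0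
  have hvN : padicValNat 3 (Ideal.absNorm (Ideal.span {2 * γ})) = 1 := by
    rw [hN, padicValNat.mul (by norm_num) hNb, hvb, padicValNat.eq_zero_of_not_dvd (by norm_num)]
  have hd : Ideal.absNorm (differentIdeal (𝓞 K) (𝓞 Kt)) ∣ Ideal.absNorm (Ideal.span {2 * γ}) :=
    map_dvd _ (Ideal.dvd_span_singleton.mpr hmem)
  have hN0 : Ideal.absNorm (Ideal.span {2 * γ}) ≠ 0 := by
    rw [hN]; exact mul_ne_zero (by norm_num) hNb
  have hle := (padicValNat_dvd_iff_le hN0 (p := 3)).mp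
    ((pow_padicValNat_dvd (p := 3)).trans hd)
  rw [hvN] at hle
  -- lower bound
  have hPb : P ∣ Ideal.span {b} := dvd_of_three_dvd_absNorm K P hP h _
    (dvd_of_one_le_padicValNat hvb.ge)
  obtain ⟨J, hJ⟩ := hPb
  have hPJ : ¬ P ∣ J := by
    rintro ⟨I, rfl⟩
    have : padicValNat 3 (Ideal.absNorm (Ideal.span {b})) =
        2 + padicValNat 3 (Ideal.absNorm I) := by
      rw [hJ, ← mul_assoc, ← pow_two] at hNb ⊢
      rw [map_mul, map_pow, hNP] at hNb ⊢
      rw [padicValNat.mul (by norm_num) (right_ne_zero_of_mul hNb), padicValNat.prime_pow]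
    omega
  obtain ⟨Q, hQmax, hQ⟩ := Ideal.exists_ideal_over_maximal_of_isIntegral (S := 𝓞 Kt) P
    (by
      rw [(RingHom.injective_iff_ker_eq_bot _).mp (FaithfulSMul.algebraMap_injective (𝓞 K) (𝓞 Kt))]
      exact bot_le)
  have hQbot : Q ≠ ⊥ := by
    rintro rfl
    apply hPbot
    rw [← hQ]
    exact (RingHom.injective_iff_ker_eq_bot _).mp
      (FaithfulSMul.algebraMap_injective (𝓞 K) (𝓞 Kt))
  have hbP : b ∈ P := by
    rw [← Ideal.dvd_span_singleton, hJ]; exact dvd_mul_right _ _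
  have hγQ : γ ∈ Q := by
    apply hQmax.isPrime.mem_of_pow_mem 2
    rw [hγ]
    rw [← hQ] at hbP
    exact hbP
  have hQ2 : Q ^ 2 ∣ P.map (algebraMap (𝓞 K) (𝓞 Kt)) := by
    have hdvd : Q ^ 2 ∣ P.map (algebraMap (𝓞 K) (𝓞 Kt)) * J.map (algebraMap (𝓞 K) (𝓞 Kt)) := by
      rw [← Ideal.map_mul, ← hJ, Ideal.map_span, Set.image_singleton, ← hγ,
        ← Ideal.span_singleton_pow]
      exact pow_dvd_pow_of_dvd (Ideal.dvd_span_singleton.mpr hγQ) 2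
    have hQprime : Prime Q := Ideal.prime_of_isPrime hQbot hQmax.isPrime
    refine hQprime.pow_dvd_of_dvd_mul_right 2 ?_ hdvd
    intro hQJ
    apply hPJ
    rw [Ideal.dvd_iff_le] at hQJ ⊢
    rw [← hQ]
    exact Ideal.map_le_iff_le_comap.mp hQJ
  have hQD : Q ∣ differentIdeal (𝓞 K) (𝓞 Kt) := by
    simpa using pow_sub_one_dvd_differentIdeal (𝓞 K) Q 2 hPbot hQ2
  have h3Q : 3 ∣ Ideal.absNorm Q := by
    have h3P : ((3 : ℕ) : 𝓞 K) ∈ P := by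
      have : ((3 : ℕ) : 𝓞 K) ∈ P ^ 3 := by rw [← h]; exact Ideal.mem_span_singleton_self _
      exact Ideal.pow_le_self (by norm_num) this
    have h3 : ((3 : ℕ) : 𝓞 Kt) ∈ Q := by
      rw [← hQ, Ideal.mem_comap, map_natCast] at h3P
      exact h3P
    obtain ⟨q, n, hn, hqQ, hq, hNQ⟩ := Ideal.exists_prime_and_absNorm_eq_pow Q
    by_cases hq3 : q = 3
    · rw [hNQ, hq3]; exact dvd_pow_self _ hn.ne'
    · exfalso
      have hcop : IsCoprime (3 : ℤ) (q : ℤ) :=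
        Nat.isCoprime_iff_coprime.mpr
          ((Nat.coprime_primes Nat.prime_three hq).mpr (Ne.symm hq3))
      obtain ⟨s, t, hst⟩ := hcop
      apply hQmax.ne_top
      rw [Ideal.eq_top_iff_one]
      have e : (1 : 𝓞 Kt) = s * ((3 : ℕ) : 𝓞 Kt) + t * (q : 𝓞 Kt) := by
        exact_mod_cast congrArg (Int.cast : ℤ → 𝓞 Kt) hst.symm
      rw [e]
      exact Q.add_mem (Q.mul_mem_left _ h3) (Q.mul_mem_left _ hqQ)
  have h3D : 3 ∣ Ideal.absNorm (differentIdeal (𝓞 K) (𝓞 Kt)) := h3Q.trans (map_dvd _ hQD)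
  have hD0 : Ideal.absNorm (differentIdeal (𝓞 K) (𝓞 Kt)) ≠ 0 := by
    intro h0; rw [h0] at hd; exact hN0 (zero_dvd_iff.mp hd)
  have := one_le_padicValNat_of_dvd hD0 h3D
  omega

lemma exists_eq_pow_mul (d : ℤ) (n : ℕ) (h0 : d ≠ 0) (h : padicValInt 3 d = n) :
    ∃ m : ℤ, ¬ (3 : ℤ) ∣ m ∧ d = 3 ^ n * m := by
  have hf : Fact (Nat.Prime 3) := ⟨Nat.prime_three⟩
  have h1 : (3 : ℤ) ^ n ∣ d := by
    have := (padicValInt_dvd_iff (p := 3) n d).mpr (Or.inr h.ge)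
    exact_mod_cast this
  obtain ⟨m, hm⟩ := h1
  refine ⟨m, ?_, hm⟩
  rintro ⟨t, rfl⟩
  have : ((3 : ℕ) : ℤ) ^ (n + 1) ∣ d := ⟨t, by rw [hm]; push_cast; ring⟩
  rcases (padicValInt_dvd_iff (p := 3) (n + 1) d).mp this with h2 | h2
  · exact h0 h2
  · omega

theorem disc_valuation_totally_ramified_at_three
    (K Kt : Type) [Field K] [NumberField K] [Field Kt] [NumberField Kt]
    [Algebra K Kt] [IsScalarTower ℚ K Kt]
    (hK3 : Module.finrank ℚ K = 3) (hKnotGal : ¬IsGalois ℚ K)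
    (hGal : IsGalois ℚ Kt) (hKt6 : Module.finrank ℚ Kt = 6)
    (hram : TotallyRamifiedAt 3 K) :
    (padicValInt 3 (NumberField.discr K) = 3 ∨
      padicValInt 3 (NumberField.discr K) = 4 ∨
      padicValInt 3 (NumberField.discr K) = 5) ∧
    (padicValInt 3 (NumberField.discr K) = 3 →
      padicValInt 3 (NumberField.discr Kt) = 7) ∧
    (padicValInt 3 (NumberField.discr K) = 4 →
      padicValInt 3 (NumberField.discr Kt) = 8) ∧
    (padicValInt 3 (NumberField.discr K) = 5 →
      padicValInt 3 (NumberField.discr Kt) = 11) := by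
  obtain ⟨P, hP, h⟩ := hram
  have h2 : Module.finrank K Kt = 2 := by
    have := Module.finrank_mul_finrank ℚ K Kt
    rw [hK3, hKt6] at this
    omega
  obtain ⟨δ, hδ, hδ0, τ, hτ⟩ := exists_sqrt_discr K Kt hK3 hKnotGal hGal h2
  refine ⟨val_discr K hK3 P hP h, fun hv => ?_, fun hv => ?_, fun hv => ?_⟩
  · obtain ⟨m, hm, hd⟩ := exists_eq_pow_mul _ _ (discr_ne_zero K) hv
    rw [val_discr_tower K Kt h2, hv,
      different_val_odd K Kt hK3 h2 P hP h τ δ hδ0 hτ m hm 1 (by rw [hδ, hd])]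
  · obtain ⟨m, hm, hd⟩ := exists_eq_pow_mul _ _ (discr_ne_zero K) hv
    rw [val_discr_tower K Kt h2, hv,
      different_val_even K Kt hK3 h2 τ δ hδ0 hτ m hm (by rw [hδ, hd]; norm_num)]
  · obtain ⟨m, hm, hd⟩ := exists_eq_pow_mul _ _ (discr_ne_zero K) hv
    rw [val_discr_tower K Kt h2, hv,
      different_val_odd K Kt hK3 h2 P hP h τ δ hδ0 hτ m hm 2 (by rw [hδ, hd])]
end

section
/- Let K be a non-cyclic cubic field with Galois closure K̃, and suppose the prime 3 is not totally ramified in K. Let r be the product of all primes that are totally ramified in K (a squarefree integer not divisible by 3). Then r²·Disc(K̃) = Disc(K)³, where Disc denotes the discriminant of the ring of integers. -/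
open NumberField

set_option linter.unusedSectionVars false

section Helpers

open Ideal
open scoped Pointwise

section basics
variable {R : Type*} [CommRing R] [IsDedekindDomain R]

lemma ideal_eq_of_emult {I J : Ideal R} (hI : I ≠ ⊥) (hJ : J ≠ ⊥)
    (h : ∀ P : Ideal R, P.IsPrime → P ≠ ⊥ → emultiplicity P I = emultiplicity P J) : I = J := by
  classical
  apply le_antisymm
  · rw [← Ideal.dvd_iff_le]
    refine (UniqueFactorizationMonoid.dvd_iff_emultiplicity_le hJ).2 fun P hP => ?_
    exact (h P (Ideal.isPrime_of_prime hP) hP.ne_zero).ge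
  · rw [← Ideal.dvd_iff_le]
    refine (UniqueFactorizationMonoid.dvd_iff_emultiplicity_le hI).2 fun P hP => ?_
    exact (h P (Ideal.isPrime_of_prime hP) hP.ne_zero).le

lemma emult_smul {G : Type*} [Group G] [MulSemiringAction G R] (g : G) (P I : Ideal R) :
    emultiplicity (g • P) (g • I) = emultiplicity P I :=
  emultiplicity_map_eq (MulDistribMulAction.toMulEquiv (Ideal R) g)

end basics

section tower
variable (K L : Type) [Field K] [NumberField K] [Field L] [NumberField L]
    [Algebra K L] [IsScalarTower ℚ K L]

lemma card_inertia_Q [IsGalois ℚ L] (P : Ideal (𝓞 L)) [P.IsPrime] (hP : P ≠ ⊥) :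
    Nat.card (P.inertia Gal(L/ℚ)) = P.ramificationIdx ℤ := by
  have : P.IsMaximal := Ring.DimensionLEOne.maximalOfPrime hP inferInstance
  have : (P.under ℤ).IsMaximal := Ideal.IsMaximal.under ℤ P
  have hb : P.under ℤ ≠ ⊥ := Ideal.under_ne_bot ℤ hP
  have : Finite (ℤ ⧸ P.under ℤ) := Ring.HasFiniteQuotients.finiteQuotient hb
  rw [card_inertia_eq_ramificationIdxIn (P.under ℤ),
    ramificationIdxIn_eq_ramificationIdx (P.under ℤ) P Gal(L/ℚ)]

lemma card_inertia_K [IsGalois K L] (P : Ideal (𝓞 L)) [P.IsPrime] (hP : P ≠ ⊥) :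
    Nat.card (P.inertia Gal(L/K)) = P.ramificationIdx (𝓞 K) := by
  have : P.IsMaximal := Ring.DimensionLEOne.maximalOfPrime hP inferInstance
  have : (P.under (𝓞 K)).IsMaximal := Ideal.IsMaximal.under (𝓞 K) P
  have hb : P.under (𝓞 K) ≠ ⊥ := Ideal.under_ne_bot (𝓞 K) hP
  have : Finite (𝓞 K ⧸ P.under (𝓞 K)) := Ring.HasFiniteQuotients.finiteQuotient hb
  rw [card_inertia_eq_ramificationIdxIn (P.under (𝓞 K)),
    ramificationIdxIn_eq_ramificationIdx (P.under (𝓞 K)) P Gal(L/K)]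

/-- The subgroup of `Gal(L/ℚ)` fixing `K`. -/
def HH : Subgroup Gal(L/ℚ) := (AlgEquiv.restrictScalarsHom ℚ : Gal(L/K) →* Gal(L/ℚ)).range

lemma card_inertia_inf (P : Ideal (𝓞 L)) :
    Nat.card (P.inertia Gal(L/K)) = Nat.card ↥(P.inertia Gal(L/ℚ) ⊓ HH K L) := by
  have : P.inertia Gal(L/ℚ) ⊓ HH K L = (P.inertia Gal(L/K)).map
      (AlgEquiv.restrictScalarsHom ℚ : Gal(L/K) →* Gal(L/ℚ)) := by
    ext g
    constructor
    · rintro ⟨h1, g, rfl⟩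
      exact ⟨g, h1, rfl⟩
    · rintro ⟨g, h1, rfl⟩
      exact ⟨h1, g, rfl⟩
  rw [this]
  exact (Nat.card_congr ((P.inertia Gal(L/K)).equivMapOfInjective _
    (AlgEquiv.restrictScalars_injective ℚ)).toEquiv)

lemma not_dvd_diff_Z (P : Ideal (𝓞 K)) [P.IsPrime] (h : P.ramificationIdx ℤ = 1) :
    ¬ P ∣ differentIdeal ℤ (𝓞 K) :=
  not_dvd_differentIdeal_iff.2 (Ideal.ramificationIdx_eq_one_iff.1 h)

lemma not_dvd_diff_K (P : Ideal (𝓞 L)) [P.IsPrime] (h : P.ramificationIdx (𝓞 K) = 1) :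
    ¬ P ∣ differentIdeal (𝓞 K) (𝓞 L) :=
  not_dvd_differentIdeal_iff.2 (Ideal.ramificationIdx_eq_one_iff.1 h)

noncomputable def JJ : Ideal (𝓞 L) := (differentIdeal ℤ (𝓞 K)).map (algebraMap (𝓞 K) (𝓞 L))

lemma diff_tower : differentIdeal ℤ (𝓞 L) = differentIdeal (𝓞 K) (𝓞 L) * JJ K L :=
  differentIdeal_eq_differentIdeal_mul_differentIdeal ℤ (𝓞 K) (𝓞 L)

lemma emult_map (P : Ideal (𝓞 L)) [P.IsPrime] (hP : P ≠ ⊥) (I : Ideal (𝓞 K)) (hI : I ≠ ⊥) :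
    emultiplicity P (I.map (algebraMap (𝓞 K) (𝓞 L))) =
      P.ramificationIdx (𝓞 K) * emultiplicity (P.under (𝓞 K)) I := by
  have hb : P.under (𝓞 K) ≠ ⊥ := Ideal.under_ne_bot (𝓞 K) hP
  rw [Ideal.IsDedekindDomain.emultiplicity_map_eq_ramificationIdx'_mul (v := P.under (𝓞 K)) hI
    (Ideal.prime_of_isPrime hb inferInstance).irreducible
    (Ideal.prime_of_isPrime hP inferInstance).irreducible hP,
    Ideal.ramificationIdx'_eq_ramificationIdx _ _ hb]

lemma emult_J_of_inf_bot [IsGalois ℚ L] (P : Ideal (𝓞 L)) [P.IsPrime] (hP : P ≠ ⊥)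
    (h : P.inertia Gal(L/ℚ) ⊓ HH K L = ⊥) :
    P.ramificationIdx (𝓞 K) = 1 ∧
    emultiplicity P (JJ K L) = emultiplicity P (differentIdeal ℤ (𝓞 L)) := by
  have : IsGalois K L := IsGalois.tower_top_of_isGalois ℚ K L
  have h1 : P.ramificationIdx (𝓞 K) = 1 := by
    rw [← card_inertia_K K L P hP, card_inertia_inf, h]; simp
  refine ⟨h1, ?_⟩
  rw [diff_tower K L, emultiplicity_mul (Ideal.prime_of_isPrime hP inferInstance),
    emultiplicity_eq_zero.2 (not_dvd_diff_K K L P h1), zero_add]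

lemma emult_J_of_le [IsGalois ℚ L] (P : Ideal (𝓞 L)) [P.IsPrime] (hP : P ≠ ⊥)
    (h : P.inertia Gal(L/ℚ) ≤ HH K L) :
    emultiplicity P (JJ K L) = 0 := by
  have : IsGalois K L := IsGalois.tower_top_of_isGalois ℚ K L
  have h1 : P.ramificationIdx (𝓞 K) = P.ramificationIdx ℤ := by
    rw [← card_inertia_K K L P hP, card_inertia_inf, inf_eq_left.2 h, card_inertia_Q L P hP]
  have h2 := Ideal.ramificationIdx_tower (R := ℤ) (P.under (𝓞 K)) P
  have h3 : (P.under (𝓞 K)).ramificationIdx ℤ = 1 := by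
    rw [h1] at h2
    have := ramificationIdx_pos P ℤ
    exact (Nat.eq_of_mul_eq_mul_right this (by simpa using h2)).symm
  have h4 := not_dvd_diff_Z K _ h3
  rw [JJ, emult_map K L P hP _ differentIdeal_ne_bot, emultiplicity_eq_zero.2 h4, mul_zero]

end tower

section cubic
variable (K : Type) [Field K] [NumberField K]

lemma emult_diff_of_tot (hK3 : Module.finrank ℚ K = 3) (p : ℕ) (hp : p.Prime) (hp3 : p ≠ 3)
    (P : Ideal (𝓞 K)) (hP : Ideal.span {(p : 𝓞 K)} = P ^ 3) :
    emultiplicity P (differentIdeal ℤ (𝓞 K)) = 2 := by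
  have hpm : (Ideal.span {(p : ℤ)}).IsMaximal :=
    PrincipalIdealRing.isMaximal_of_irreducible (Nat.prime_iff_prime_int.1 hp).irreducible
  have hp0 : Ideal.span {(p : ℤ)} ≠ ⊥ := by simpa using hp.ne_zero
  have hmap : (Ideal.span {(p : ℤ)}).map (algebraMap ℤ (𝓞 K)) = P ^ 3 := by
    rw [Ideal.map_span, ← hP]; simp
  refine (emultiplicity_eq_coe (n := 2)).2 ⟨?_, ?_⟩
  · exact pow_sub_one_dvd_differentIdeal ℤ (p := Ideal.span {(p : ℤ)}) P 3 hp0 (by rw [hmap])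
  · refine not_dvd_differentIdeal_of_intTrace_not_mem ℤ (p := Ideal.span {(p : ℤ)}) (P ^ 3) ⊤
      (by rw [hmap, Ideal.mul_top]) 1 trivial ?_
    have h3 : Algebra.intTrace ℤ (𝓞 K) 1 = 3 := by
      rw [Algebra.intTrace_eq_trace]
      have := Algebra.trace_algebraMap (R := ℤ) (S := 𝓞 K) 1
      rw [RingOfIntegers.rank, hK3] at this
      simpa using this
    rw [h3, Ideal.mem_span_singleton]
    intro h
    have h' : p ∣ 3 := by exact_mod_cast h
    exact hp3 ((Nat.prime_dvd_prime_iff_eq hp Nat.prime_three).1 h')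

lemma ramIdx_of_tot (p : ℕ) (hp : p.Prime) (P : Ideal (𝓞 K)) [P.IsPrime]
    (hP : Ideal.span {(p : 𝓞 K)} = P ^ 3) : P.ramificationIdx ℤ = 3 := by
  have hpm : (Ideal.span {(p : ℤ)}).IsMaximal :=
    PrincipalIdealRing.isMaximal_of_irreducible (Nat.prime_iff_prime_int.1 hp).irreducible
  have hp0 : Ideal.span {(p : ℤ)} ≠ ⊥ := by simpa using hp.ne_zero
  have hmap : (Ideal.span {(p : ℤ)}).map (algebraMap ℤ (𝓞 K)) = P ^ 3 := by
    rw [Ideal.map_span, ← hP]; simp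
  have hb : P ≠ ⊥ := by
    rintro rfl
    have : (p : 𝓞 K) = 0 := by simpa using hP
    exact hp.ne_zero (by exact_mod_cast this)
  have : P.LiesOver (Ideal.span {(p : ℤ)}) := by
    constructor
    refine hpm.eq_of_le (Ideal.IsPrime.ne_top inferInstance) ?_
    rw [Ideal.span_singleton_le_iff_mem, Ideal.under_def, Ideal.mem_comap]
    have : (p : 𝓞 K) ∈ P ^ 3 := hP ▸ Ideal.mem_span_singleton_self _
    simpa using Ideal.pow_le_self (by norm_num) this
  rw [Ideal.IsDedekindDomain.ramificationIdx_eq_multiplicity (Ideal.span {(p : ℤ)}) P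
    (by rw [hmap]; exact pow_ne_zero _ hb), hmap]
  exact multiplicity_pow_self_of_prime (Ideal.prime_of_isPrime hb inferInstance) 3

lemma tot_of_ramIdx (hK3 : Module.finrank ℚ K = 3) (p : ℕ) (hp : p.Prime)
    (P : Ideal (𝓞 K)) [P.IsPrime] (hpP : (p : 𝓞 K) ∈ P) (h : P.ramificationIdx ℤ = 3) :
    Ideal.span {(p : 𝓞 K)} = P ^ 3 := by
  have hpm : (Ideal.span {(p : ℤ)}).IsMaximal :=
    PrincipalIdealRing.isMaximal_of_irreducible (Nat.prime_iff_prime_int.1 hp).irreducible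
  have hmap : (Ideal.span {(p : ℤ)}).map (algebraMap ℤ (𝓞 K)) = Ideal.span {(p : 𝓞 K)} := by
    rw [Ideal.map_span]; simp
  have hover : P.LiesOver (Ideal.span {(p : ℤ)}) := by
    constructor
    refine hpm.eq_of_le (Ideal.IsPrime.ne_top inferInstance) ?_
    rw [Ideal.span_singleton_le_iff_mem, Ideal.under_def, Ideal.mem_comap]
    simpa using hpP
  have hne : Ideal.span {(p : 𝓞 K)} ≠ ⊥ := by
    simpa using hp.ne_zero
  have hdvd : P ^ 3 ∣ Ideal.span {(p : 𝓞 K)} := by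
    rw [← h, Ideal.IsDedekindDomain.ramificationIdx_eq_multiplicity (Ideal.span {(p : ℤ)}) P
      (by rw [hmap]; exact hne), hmap]
    exact pow_multiplicity_dvd _ _
  obtain ⟨a, ha⟩ := hdvd
  have hN : (p : ℤ) ∣ (Ideal.absNorm P : ℤ) := by
    rw [← Ideal.mem_span_singleton, hover.over, Ideal.under_def, Ideal.mem_comap]
    simpa using Ideal.absNorm_mem P
  have hN' : p ∣ Ideal.absNorm P := by exact_mod_cast hN
  have hn : Ideal.absNorm (Ideal.span {(p : 𝓞 K)}) = p ^ 3 := by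
    rw [Ideal.absNorm_span_singleton]
    have := Algebra.norm_algebraMap (R := ℤ) (S := 𝓞 K) (p : ℤ)
    rw [RingOfIntegers.rank, hK3] at this
    simp only [algebraMap_int_eq, eq_intCast, Int.cast_natCast] at this
    rw [this]; simp [Int.natAbs_pow]
  have h2 := congrArg Ideal.absNorm ha
  rw [hn, map_mul, map_pow] at h2
  obtain ⟨c, hc⟩ := hN'
  rw [hc, mul_pow, mul_assoc] at h2
  have h3 : c ^ 3 * Ideal.absNorm a = 1 := by
    have : 0 < p ^ 3 := pow_pos hp.pos 3
    exact Nat.eq_of_mul_eq_mul_left this (by simpa using h2.symm)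
  have h4 : Ideal.absNorm a = 1 := Nat.eq_one_of_mul_eq_one_left h3
  rw [ha, Ideal.absNorm_eq_one_iff.1 h4, Ideal.mul_top]

end cubic

section wild
variable (L : Type) [Field L] [NumberField L]

lemma three_mem_of_inertia_top [IsGalois ℚ L] (h6 : Module.finrank ℚ L = 6)
    (P : Ideal (𝓞 L)) [P.IsPrime] (hP : P ≠ ⊥)
    (htop : P.inertia Gal(L/ℚ) = ⊤) (a b σ τ : Gal(L/ℚ)) (hσ : σ * (b * a) = a * b)
    (hσ3 : σ ^ 3 = 1) (hτ : τ * τ = 1) (hτσ : σ * τ = τ * σ ^ 2)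
    (hgen : Subgroup.closure {σ, τ} = ⊤) : (3 : 𝓞 L) ∈ P := by
  by_contra h3
  have hstab : ∀ g : Gal(L/ℚ), g • P = P := fun g =>
    Ideal.inertia_le_stabilizer (M := Gal(L/ℚ)) P (htop ▸ Subgroup.mem_top g)
  have hstab2 : ∀ (n : ℕ) (g : Gal(L/ℚ)) (x : 𝓞 L), g • x ∈ P ^ n ↔ x ∈ P ^ n := by
    intro n g x
    have : g • (P ^ n) = P ^ n := by rw [smul_pow', hstab]
    conv_lhs => rw [← this]
    exact Ideal.smul_mem_pointwise_smul_iff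
  have hin : ∀ (g : Gal(L/ℚ)) (x : 𝓞 L), g • x - x ∈ P := fun g x =>
    (htop ▸ Subgroup.mem_top g : g ∈ P.inertia Gal(L/ℚ)) x
  obtain ⟨x, hx1, hx2⟩ := Ideal.exists_mem_pow_notMem_pow_succ P hP (Ideal.IsPrime.ne_top inferInstance) 1
  have hu : ∀ g : Gal(L/ℚ), ∃ u : 𝓞 L, g • x - u * x ∈ P ^ 2 := by
    intro g
    obtain ⟨d, e, he, h⟩ := Ideal.exists_mul_add_mem_pow_succ hP x (g • x) hx1 hx2
      ((hstab2 1 g x).2 hx1)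
    refine ⟨d, ?_⟩
    rw [← h]; convert he using 1; ring
  obtain ⟨u, hua⟩ := hu a
  obtain ⟨v, hvb⟩ := hu b
  have hxP : x ∈ P := by simpa using hx1
  have key : ∀ (g : Gal(L/ℚ)) (s w : 𝓞 L) (y : 𝓞 L), g • x - s * x ∈ P ^ 2 → y - w * x ∈ P ^ 2 →
      g • y - s * w * x ∈ P ^ 2 := by
    intro g s w y h1 h2
    have e : g • y - s * w * x = g • (y - w * x) + (g • w - w) * (g • x) + w * (g • x - s * x) := by
      simp only [smul_sub, smul_mul']; ring
    rw [e]
    refine add_mem (add_mem ((hstab2 2 g _).2 h2) ?_) (Ideal.mul_mem_left _ _ h1)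
    rw [pow_two]
    exact Ideal.mul_mem_mul (hin g w) (by simpa using (hstab2 1 g x).2 hx1)
  have hab : (a * b) • x - u * v * x ∈ P ^ 2 := by
    rw [mul_smul]; exact key a u v _ hua hvb
  have hba : (b * a) • x - v * u * x ∈ P ^ 2 := by
    rw [mul_smul]; exact key b v u _ hvb hua
  set y := (b * a) • x with hy
  have hy2 : y ∉ P ^ 2 := fun h => hx2 ((hstab2 2 _ x).1 h)
  have hy1 : y ∈ P := by simpa using (hstab2 1 (b * a) x).2 hx1
  have hs1 : σ • y - y ∈ P ^ 2 := by
    have : σ • y = (a * b) • x := by rw [hy, ← mul_smul, hσ]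
    rw [this]
    convert sub_mem hab hba using 1; ring
  have hs2 : σ ^ 2 • y - y ∈ P ^ 2 := by
    have : σ ^ 2 • y - y = σ • (σ • y - y) + (σ • y - y) := by
      rw [smul_sub, pow_two, mul_smul]; ring
    rw [this]
    exact add_mem ((hstab2 2 σ _).2 hs1) hs1
  set t := y + σ • y + σ ^ 2 • y with ht
  have ht2 : t ∉ P ^ 2 := by
    intro h
    have : (3 : 𝓞 L) * y ∈ P ^ 2 := by
      have e : 3 * y = t - (σ • y - y) - (σ ^ 2 • y - y) := by rw [ht]; ring
      rw [e]
      exact sub_mem (sub_mem h hs1) hs2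
    rcases Ideal.IsPrime.mul_mem_pow P this with h | h
    · exact h3 h
    · exact hy2 h
  have hτt2 : τ • t ∉ P ^ 2 := fun h => ht2 ((hstab2 2 τ t).1 h)
  have ht1 : t ∈ P := by
    have e : t = (σ • y - y) + (σ ^ 2 • y - y) + 3 * y := by rw [ht]; ring
    rw [e]
    exact add_mem (add_mem (hin _ _) (hin _ _)) (Ideal.mul_mem_left _ _ hy1)
  have hσt : σ • t = t := by
    have e1 : σ • σ • y = σ ^ 2 • y := by rw [← mul_smul, pow_two]
    have e2 : σ • σ ^ 2 • y = y := by rw [← mul_smul, ← pow_succ', hσ3, one_smul]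
    rw [ht, smul_add, smul_add, e1, e2]; ring
  have hσN : σ • (t * τ • t) = t * τ • t := by
    rw [smul_mul', ← mul_smul, hτσ, mul_smul, hσt, pow_two, mul_smul, hσt, hσt]
  have hτN : τ • (t * τ • t) = t * τ • t := by
    rw [smul_mul', ← mul_smul, hτ, one_smul, mul_comm]
  have hGN : ∀ g : Gal(L/ℚ), g • (t * τ • t) = t * τ • t := by
    have : Subgroup.closure {σ, τ} ≤ MulAction.stabilizer Gal(L/ℚ) (t * τ • t) := by
      rw [Subgroup.closure_le]
      rintro g (rfl | rfl)
      · exact hσN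
      · exact hτN
    intro g
    exact this (hgen ▸ Subgroup.mem_top g)
  obtain ⟨n, hn⟩ := Algebra.IsInvariant.isInvariant (A := ℤ) (G := Gal(L/ℚ)) (t * τ • t) hGN
  have hnP : n ∈ P.under ℤ := by
    rw [Ideal.under_def, Ideal.mem_comap, hn]; exact Ideal.mul_mem_right _ _ ht1
  have hunder : P.under ℤ ≠ ⊥ := Ideal.under_ne_bot ℤ hP
  have he : P.ramificationIdx ℤ = 6 := by
    rw [← card_inertia_Q L P hP, htop, Subgroup.card_top, IsGalois.card_aut_eq_finrank, h6]
  have hmem : t * τ • t ∈ P ^ 6 := by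
    rw [← hn, ← he, ← Ideal.ramificationIdx'_eq_ramificationIdx (P.under ℤ) P hunder]
    exact Ideal.le_pow_ramificationIdx' (Ideal.mem_map_of_mem _ hnP)
  have hprime : Prime P := Ideal.prime_of_isPrime hP inferInstance
  have hlt : ∀ z : 𝓞 L, z ∉ P ^ 2 → emultiplicity P (Ideal.span {z}) ≤ 1 := by
    intro z hz
    have h := (emultiplicity_lt_iff_not_dvd (a := P) (b := Ideal.span {z}) (k := 2)).2 (by
      rwa [Ideal.dvd_span_singleton])
    exact (ENat.lt_natCast_add_one_iff (n := 1)).1 h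
  have h1 : (6 : ℕ) ≤ emultiplicity P (Ideal.span {t * τ • t}) :=
    le_emultiplicity_of_pow_dvd (by rwa [Ideal.dvd_span_singleton])
  rw [← Ideal.span_singleton_mul_span_singleton, emultiplicity_mul hprime] at h1
  have h2 := h1.trans (add_le_add (hlt _ ht2) (hlt _ hτt2))
  exact absurd h2 (by decide)

end wild

section group
variable {G : Type*} [Group G] [Finite G]

lemma grp_iso (hG : Nat.card G = 6) (H : Subgroup G) (hH : Nat.card H = 2) (hn : ¬ H.Normal) :
    Nonempty (G ≃* Equiv.Perm (Fin 3)) := by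
  have hidx : Nat.card (G ⧸ H) = 3 := by
    have := H.card_mul_index
    rw [hH, hG, Subgroup.index] at this
    omega
  have hker : (MulAction.toPermHom G (G ⧸ H)).ker = ⊥ := by
    rw [← Subgroup.normalCore_eq_ker]
    have hle := H.normalCore_le
    have hd : Nat.card H.normalCore ∣ 2 := hH ▸ Subgroup.card_dvd_of_le hle
    rcases (Nat.dvd_prime Nat.prime_two).1 hd with h | h
    · exact Subgroup.card_eq_one.1 h
    · exfalso
      have : H.normalCore = H := Subgroup.eq_of_le_of_card_ge hle (by rw [hH, h])
      exact hn (this ▸ inferInstance)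
  have hinj : Function.Injective (MulAction.toPermHom G (G ⧸ H)) :=
    (MonoidHom.ker_eq_bot_iff _).1 hker
  have hbij : Function.Bijective (MulAction.toPermHom G (G ⧸ H)) := by
    rw [Nat.bijective_iff_injective_and_card]
    refine ⟨hinj, ?_⟩
    rw [hG, Nat.card_perm, hidx]; rfl
  obtain ⟨e⟩ : Nonempty (G ⧸ H ≃ Fin 3) := ⟨Finite.equivFinOfCardEq hidx⟩
  exact ⟨(MulEquiv.ofBijective _ hbij).trans e.permCongrHom⟩

lemma grp_two (I : Subgroup G) (hI : Nat.card I = 2) :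
    ∃ i : G, i ≠ 1 ∧ i * i = 1 ∧ ∀ x, x ∈ I ↔ x = 1 ∨ x = i := by
  obtain ⟨i, hi⟩ := (Nat.card_eq_two_iff' (1 : I)).1 hI
  have hne : (i : G) ≠ 1 := fun h => hi.1 (Subtype.ext h)
  have hall : ∀ x, x ∈ I ↔ x = 1 ∨ x = i := by
    intro x
    constructor
    · intro hx
      by_cases h : x = 1
      · exact Or.inl h
      · right
        have := hi.2 ⟨x, hx⟩ (fun h' => h (congrArg Subtype.val h'))
        exact congrArg Subtype.val this
    · rintro (rfl | rfl)
      · exact I.one_mem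
      · exact i.2
  refine ⟨i, hne, ?_, hall⟩
  rcases (hall (i * i)).1 (I.mul_mem i.2 i.2) with h | h
  · exact h
  · exact absurd (mul_eq_left.1 h) hne

lemma perm3_aux : ∀ i h : Equiv.Perm (Fin 3), i ≠ 1 → i * i = 1 → h ≠ 1 → h * h = 1 →
    (Finset.univ.filter fun g : Equiv.Perm (Fin 3) => g * h * g⁻¹ = i).card = 2 := by decide

lemma grp_inertia2 [Fintype G] (hG : Nat.card G = 6) (H : Subgroup G) (hH : Nat.card H = 2)
    (hn : ¬ H.Normal) (I : Subgroup G) (hI : Nat.card I = 2) :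
    ∃ T : Finset G, T.card = 2 ∧ (∀ g ∈ T, ∀ x, g * x * g⁻¹ ∈ I → x ∈ H) ∧
      (∀ g ∉ T, ∀ x, g * x * g⁻¹ ∈ I → x ∈ H → x = 1) := by
  classical
  obtain ⟨e⟩ := grp_iso hG H hH hn
  obtain ⟨i, hi, hii, hIm⟩ := grp_two I hI
  obtain ⟨h, hh, hhh, hHm⟩ := grp_two H hH
  refine ⟨Finset.univ.filter fun g => g * h * g⁻¹ = i, ?_, ?_, ?_⟩
  · rw [← perm3_aux (e i) (e h) (by simpa using hi) (by rw [← map_mul, hii, map_one])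
      (by simpa using hh) (by rw [← map_mul, hhh, map_one])]
    refine Finset.card_bij (fun g _ => e g) ?_ ?_ ?_
    · intro g hg
      simp only [Finset.mem_filter, Finset.mem_univ, true_and] at hg ⊢
      rw [← hg]; simp
    · intro a _ b _ hab
      exact e.injective hab
    · intro b hb
      simp only [Finset.mem_filter, Finset.mem_univ, true_and] at hb
      refine ⟨e.symm b, ?_, by simp⟩
      simp only [Finset.mem_filter, Finset.mem_univ, true_and]
      apply e.injective
      simpa using hb
  · intro g hg x hx
    simp only [Finset.mem_filter, Finset.mem_univ, true_and] at hg
    rcases (hIm _).1 hx with h1 | h1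
    · have : x = 1 := by simpa using h1
      rw [this]; exact H.one_mem
    · rw [← hg] at h1
      have : x = h := by simpa using h1
      rw [this]; exact (hHm h).2 (Or.inr rfl)
  · intro g hg x hx hxH
    simp only [Finset.mem_filter, Finset.mem_univ, true_and] at hg
    rcases (hHm _).1 hxH with h1 | h1
    · exact h1
    · rcases (hIm _).1 hx with h2 | h2
      · simpa using h2
      · exact absurd (h1 ▸ h2) hg

lemma grp_inertia3 (H : Subgroup G) (hH : Nat.card H = 2)
    (I : Subgroup G) (hI : Nat.card I = 3) (g x : G) (hx : g * x * g⁻¹ ∈ I) (hxH : x ∈ H) :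
    x = 1 := by
  have h1 : x ^ 2 = 1 := by
    have := pow_card_eq_one' (x := (⟨x, hxH⟩ : H))
    rw [hH] at this
    exact congrArg Subtype.val this
  have h2 : (g * x * g⁻¹) ^ 3 = 1 := by
    have := pow_card_eq_one' (x := (⟨_, hx⟩ : I))
    rw [hI] at this
    exact congrArg Subtype.val this
  rw [conj_pow] at h2
  have h3 : x ^ 3 = 1 := by simpa using h2
  rwa [pow_succ, h1, one_mul] at h3

lemma perm3_aux2 : ∃ a b s t : Equiv.Perm (Fin 3), s * (b * a) = a * b ∧ s ^ 3 = 1 ∧ t * t = 1 ∧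
    s * t = t * s ^ 2 ∧ ∀ g : Equiv.Perm (Fin 3), ∃ i j : Fin 3, g = s ^ (i : ℕ) * t ^ (j : ℕ) := by
  refine ⟨Equiv.swap 0 1, Equiv.swap 1 2, (Equiv.swap 0 1 * Equiv.swap 1 2)^2, Equiv.swap 0 1, ?_⟩
  decide

lemma grp_gens (hG : Nat.card G = 6) (H : Subgroup G) (hH : Nat.card H = 2) (hn : ¬ H.Normal) :
    ∃ a b s t : G, s * (b * a) = a * b ∧ s ^ 3 = 1 ∧ t * t = 1 ∧
      s * t = t * s ^ 2 ∧ Subgroup.closure {s, t} = ⊤ := by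
  obtain ⟨e⟩ := grp_iso hG H hH hn
  obtain ⟨a, b, s, t, h1, h2, h3, h4, h5⟩ := perm3_aux2
  refine ⟨e.symm a, e.symm b, e.symm s, e.symm t, ?_, ?_, ?_, ?_, ?_⟩
  · simp only [← map_mul, h1]
  · rw [← map_pow, h2, map_one]
  · rw [← map_mul, h3, map_one]
  · simp only [← map_mul, ← map_pow, h4]
  · rw [eq_top_iff]
    intro g _
    obtain ⟨i, j, h⟩ := h5 (e g)
    have : g = e.symm s ^ (i : ℕ) * e.symm t ^ (j : ℕ) := by
      rw [← map_pow, ← map_pow, ← map_mul, ← h]; simp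
    rw [this]
    exact mul_mem (pow_mem (Subgroup.subset_closure (by simp)) _)
      (pow_mem (Subgroup.subset_closure (by simp)) _)

end group

section groupfacts
variable (K L : Type) [Field K] [NumberField K] [Field L] [NumberField L]
    [Algebra K L] [IsScalarTower ℚ K L]

lemma finrank_KL (hK3 : Module.finrank ℚ K = 3) (hL6 : Module.finrank ℚ L = 6) :
    Module.finrank K L = 2 := by
  have := Module.finrank_mul_finrank ℚ K L
  rw [hK3, hL6] at this
  omega

lemma card_HH [IsGalois ℚ L] (hK3 : Module.finrank ℚ K = 3) (hL6 : Module.finrank ℚ L = 6) :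
    Nat.card (HH K L) = 2 := by
  have : IsGalois K L := IsGalois.tower_top_of_isGalois ℚ K L
  rw [← finrank_KL K L hK3 hL6, ← IsGalois.card_aut_eq_finrank K L]
  exact (Nat.card_congr (MonoidHom.ofInjective
    (AlgEquiv.restrictScalars_injective ℚ : Function.Injective
      (AlgEquiv.restrictScalarsHom ℚ : Gal(L/K) →* Gal(L/ℚ)))).toEquiv).symm

lemma mem_HH (g : Gal(L/ℚ)) :
    g ∈ HH K L ↔ ∀ x : K, g (algebraMap K L x) = algebraMap K L x := by
  constructor
  · rintro ⟨h, rfl⟩ x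
    exact h.commutes x
  · intro h
    exact ⟨AlgEquiv.ofRingEquiv (f := g.toRingEquiv) h, by ext; rfl⟩

lemma HH_eq : HH K L = (IsScalarTower.toAlgHom ℚ K L).fieldRange.fixingSubgroup := by
  ext g
  rw [mem_HH, IntermediateField.mem_fixingSubgroup_iff]
  constructor
  · rintro h _ ⟨x, rfl⟩
    exact h x
  · intro h x
    exact h _ ⟨x, rfl⟩

lemma HH_not_normal [IsGalois ℚ L] (hK : ¬ IsGalois ℚ K) : ¬ (HH K L).Normal := by
  intro h
  apply hK
  have h1 := IsGalois.of_fixedField_normal_subgroup (HH K L)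
  rw [HH_eq, IsGalois.fixedField_fixingSubgroup] at h1
  refine @IsGalois.of_algEquiv _ _ _ _ _ _ _ _ h1 ?_
  exact (AlgEquiv.ofInjectiveField (IsScalarTower.toAlgHom ℚ K L)).symm

lemma mem_inertia_conj (P : Ideal (𝓞 L)) (g x : Gal(L/ℚ)) :
    x ∈ (g⁻¹ • P).inertia Gal(L/ℚ) ↔ g * x * g⁻¹ ∈ P.inertia Gal(L/ℚ) := by
  constructor
  · intro h y
    have := h (g⁻¹ • y)
    have h2 := (Ideal.mem_inv_pointwise_smul_iff).1 this
    simpa [smul_sub, mul_smul] using h2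
  · intro h y
    refine (Ideal.mem_inv_pointwise_smul_iff).2 ?_
    have := h (g • y)
    simpa [smul_sub, mul_smul] using this

lemma algEquiv_diff (g : Gal(L/ℚ)) : g • differentIdeal ℤ (𝓞 L) ≤ differentIdeal ℤ (𝓞 L) := by
  have key : ∀ x : 𝓞 L, x ∈ differentIdeal ℤ (𝓞 L) ↔
      ∀ y : L, (∀ a : 𝓞 L, ∃ n : ℤ, (n : ℚ) = Algebra.trace ℚ L (y * a)) →
        ∃ b : 𝓞 L, (b : L) = x * y := by
    intro x
    have h1 : x ∈ differentIdeal ℤ (𝓞 L) ↔ algebraMap (𝓞 L) L x ∈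
      IsLocalization.coeSubmodule L (differentIdeal ℤ (𝓞 L)) := by
      rw [IsLocalization.mem_coeSubmodule]
      constructor
      · intro h; exact ⟨x, h, rfl⟩
      · rintro ⟨y, hy, h⟩
        rwa [← FaithfulSMul.algebraMap_injective (𝓞 L) L h]
    rw [h1, coeSubmodule_differentIdeal ℤ ℚ, Submodule.mem_div_iff_forall_mul_mem]
    refine forall_congr' fun y => ?_
    rw [Submodule.mem_traceDual, Submodule.mem_one]
    refine imp_congr ?_ Iff.rfl
    constructor
    · intro h a
      obtain ⟨n, hn⟩ := h a (Submodule.mem_one.2 ⟨a, rfl⟩)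
      exact ⟨n, by simpa using hn⟩
    · rintro h a ha
      obtain ⟨a, rfl⟩ := Submodule.mem_one.1 ha
      obtain ⟨n, hn⟩ := h a
      exact ⟨n, by simpa using hn⟩
  intro z hz
  rw [key]
  have hx := (key _).1 (Ideal.mem_pointwise_smul_iff_inv_smul_mem.1 hz)
  intro y hy
  obtain ⟨b, hb⟩ := hx (g⁻¹ y) (by
    intro a
    obtain ⟨n, hn⟩ := hy (g • a)
    refine ⟨n, hn.trans ?_⟩
    rw [← Algebra.trace_eq_of_algEquiv g (g⁻¹ y * a)]
    congr 1
    rw [map_mul]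
    congr 1
    change y = (g * g⁻¹) y
    simp)
  refine ⟨g • b, ?_⟩
  change g b = _
  rw [hb, map_mul]
  congr 1
  · change (g * g⁻¹) z = z
    simp
  · change (g * g⁻¹) y = y
    simp

lemma smul_diff (g : Gal(L/ℚ)) : g • differentIdeal ℤ (𝓞 L) = differentIdeal ℤ (𝓞 L) := by
  apply le_antisymm (algEquiv_diff L g)
  have := Ideal.pointwise_smul_subset_iff.1 (algEquiv_diff L g⁻¹)
  simpa using this

end groupfacts

section signs
variable (K L : Type) [Field K] [NumberField K] [Field L] [NumberField L]
    [Algebra K L] [IsScalarTower ℚ K L]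

lemma totReal_up [IsGalois ℚ L] (hK3 : Module.finrank ℚ K = 3) (hL6 : Module.finrank ℚ L = 6)
    (hK : ¬ IsGalois ℚ K) [IsTotallyReal K] : IsTotallyReal L := by
  have hM : ∀ (g : Gal(L/ℚ)) (x : K), g (algebraMap K L x) ∈ maximalRealSubfield L := by
    intro g x φ
    have := IsTotallyReal.complexEmbedding_isReal
      ((φ.comp (g : L →+* L)).comp (algebraMap K L))
    exact RingHom.congr_fun (ComplexEmbedding.isReal_iff.1 this) x
  let M : IntermediateField ℚ L :=
    (maximalRealSubfield L).toIntermediateField (fun q => by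
      rw [eq_ratCast]; exact SubfieldClass.ratCast_mem _ q)
  have hMcore : M.fixingSubgroup ≤ (HH K L).normalCore := by
    intro h hh g
    rw [mem_HH]
    intro x
    have h1 := (IntermediateField.mem_fixingSubgroup_iff _ _).1 hh _ (hM g⁻¹ x)
    change g (h (g⁻¹ (algebraMap K L x))) = _
    rw [h1]
    change (g * g⁻¹) _ = _
    simp
  have hbot : (HH K L).normalCore = ⊥ := by
    by_contra hne
    have hcard := card_HH K L hK3 hL6
    have h2 := Subgroup.card_dvd_of_le (HH K L).normalCore_le
    rw [hcard] at h2
    have h3 : Nat.card (HH K L).normalCore ≠ 1 := fun h => hne (Subgroup.card_eq_one.1 h)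
    have h4 : Nat.card (HH K L).normalCore = 2 :=
      ((Nat.dvd_prime Nat.prime_two).1 h2).resolve_left h3
    have h5 : (HH K L).normalCore = HH K L :=
      Subgroup.eq_of_le_of_card_ge (HH K L).normalCore_le (by rw [h4, hcard])
    apply HH_not_normal K L hK
    rw [← h5]
    infer_instance
  have hMtop : M = ⊤ := by
    rw [← IsGalois.fixedField_fixingSubgroup M, le_bot_iff.1 (hMcore.trans hbot.le)]
    exact IntermediateField.fixedField_bot
  rw [← maximalRealSubfield_eq_top_iff_isTotallyReal, eq_top_iff]
  intro x _
  have : x ∈ M := by rw [hMtop]; trivial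
  exact this

open InfinitePlace in
lemma sign_eq [IsGalois ℚ L] (hK3 : Module.finrank ℚ K = 3) (hL6 : Module.finrank ℚ L = 6)
    (hK : ¬ IsGalois ℚ K) : (discr L).sign = (discr K).sign := by
  rw [sign_discr, sign_discr]
  by_cases hr : IsTotallyReal K
  · have := totReal_up K L hK3 hL6 hK
    rw [IsTotallyReal.nrComplexPlaces_eq_zero, IsTotallyReal.nrComplexPlaces_eq_zero]
  · have hLr : ¬ IsTotallyReal L := fun h => hr (IsTotallyReal.of_algebra K L)
    have h1 := card_add_two_mul_card_eq_rank K
    have h2 : nrComplexPlaces K ≠ 0 := fun h => hr ((nrComplexPlaces_eq_zero_iff).1 h)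
    have h3 : nrComplexPlaces K = 1 := by omega
    have hLc : IsTotallyComplex L := by
      refine ⟨fun v => ?_⟩
      by_contra hv
      apply hLr
      refine ⟨fun w => ?_⟩
      rw [not_isComplex_iff_isReal] at hv
      obtain ⟨σ, rfl⟩ := exists_smul_eq_of_comap_eq (k := ℚ) (w := v) (w' := w)
        (Subsingleton.elim _ _)
      exact isReal_smul_iff.2 hv
    have h4 := card_add_two_mul_card_eq_rank L
    rw [IsTotallyComplex.nrRealPlaces_eq_zero] at h4
    have h5 : nrComplexPlaces L = 3 := by omega
    rw [h3, h5]; norm_num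

end signs

section mainid
variable (K L : Type) [Field K] [NumberField K] [Field L] [NumberField L]
    [Algebra K L] [IsScalarTower ℚ K L]

lemma under_of_tot (p : ℕ) (hp : p.Prime) (𝔭 : Ideal (𝓞 K)) [𝔭.IsPrime]
    (h𝔭 : Ideal.span {(p : 𝓞 K)} = 𝔭 ^ 3) (P : Ideal (𝓞 L)) [P.IsPrime]
    (hpP : (p : 𝓞 L) ∈ P) : P.under (𝓞 K) = 𝔭 := by
  have h1 : 𝔭 ^ 3 ≤ P.under (𝓞 K) := by
    rw [← h𝔭, Ideal.span_singleton_le_iff_mem, Ideal.mem_comap]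
    simpa using hpP
  have h2 : 𝔭 ≤ P.under (𝓞 K) := Ideal.IsPrime.le_of_pow_le h1
  have h3 : 𝔭 ≠ ⊥ := by
    rintro rfl
    have : (p : 𝓞 K) = 0 := by
      rw [← Ideal.span_singleton_eq_bot, h𝔭]; simp
    exact hp.ne_zero (by exact_mod_cast this)
  have : 𝔭.IsMaximal := Ring.DimensionLEOne.maximalOfPrime h3 inferInstance
  exact (this.eq_of_le (Ideal.IsPrime.ne_top inferInstance) h2).symm

lemma three_dvd_of_tot (p : ℕ) (hp : p.Prime) (h : TotallyRamifiedAt p K)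
    (P : Ideal (𝓞 L)) [P.IsPrime] (hpP : (p : 𝓞 L) ∈ P) : 3 ∣ P.ramificationIdx ℤ := by
  obtain ⟨𝔭, _, h𝔭⟩ := h
  have h1 := under_of_tot K L p hp 𝔭 h𝔭 P hpP
  rw [Ideal.ramificationIdx_tower (R := ℤ) (P.under (𝓞 K)) P, h1, ramIdx_of_tot K p hp 𝔭 h𝔭]
  exact dvd_mul_right _ _

lemma emult_span_prod (S : Finset ℕ) (P : Ideal (𝓞 L)) [P.IsPrime] (hP : P ≠ ⊥) :
    emultiplicity P (Ideal.span {((∏ p ∈ S, p : ℕ) : 𝓞 L)}) =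
      ∑ p ∈ S, emultiplicity P (Ideal.span {(p : 𝓞 L)}) := by
  rw [Nat.cast_prod, ← Ideal.prod_span_singleton,
    Finset.emultiplicity_prod (Ideal.prime_of_isPrime hP inferInstance)]

lemma emult_span_zero (p : ℕ) (P : Ideal (𝓞 L)) (hpP : (p : 𝓞 L) ∉ P) :
    emultiplicity P (Ideal.span {(p : 𝓞 L)}) = 0 := by
  rw [emultiplicity_eq_zero, Ideal.dvd_span_singleton]
  exact hpP

lemma prime_unique (P : Ideal (𝓞 L)) [P.IsPrime] (p q : ℕ) (hp : p.Prime) (hq : q.Prime)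
    (h1 : (p : 𝓞 L) ∈ P) (h2 : (q : 𝓞 L) ∈ P) : p = q := by
  by_contra hne
  have hc := (Nat.coprime_primes hp hq).2 hne
  have h3 := (Nat.isCoprime_iff_coprime.2 hc).map (Int.castRingHom (𝓞 L))
  obtain ⟨a, b, hab⟩ := h3
  apply (inferInstance : P.IsPrime).ne_top
  rw [Ideal.eq_top_iff_one, ← hab]
  exact P.add_mem (P.mul_mem_left _ (by simpa using h1)) (P.mul_mem_left _ (by simpa using h2))

lemma exists_prime_mem (P : Ideal (𝓞 L)) [P.IsPrime] (hP : P ≠ ⊥) :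
    ∃ p : ℕ, p.Prime ∧ (p : 𝓞 L) ∈ P := by
  have : P.IsMaximal := Ring.DimensionLEOne.maximalOfPrime hP inferInstance
  have hb : P.under ℤ ≠ ⊥ := Ideal.under_ne_bot ℤ hP
  have hpr : (P.under ℤ).IsPrime := inferInstance
  refine ⟨Ideal.absNorm (P.under ℤ), ?_, ?_⟩
  · rw [Nat.prime_iff_prime_int, ← Ideal.span_singleton_prime, Int.ideal_span_absNorm_eq_self]
    · exact hpr
    · exact_mod_cast Ideal.absNorm_eq_zero_iff.not.2 hb
  · have := Ideal.absNorm_mem (P.under ℤ)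
    rw [Ideal.mem_comap] at this
    simpa using this

/-- the multiplicities in the totally ramified case -/
lemma emult_tot (hK3 : Module.finrank ℚ K = 3) (p : ℕ) (hp : p.Prime) (hp3 : p ≠ 3)
    (S : Finset ℕ) (hS : ∀ p : ℕ, p ∈ S ↔ p.Prime ∧ TotallyRamifiedAt p K) (hpS : p ∈ S)
    (P : Ideal (𝓞 L)) [P.IsPrime] (hP : P ≠ ⊥) (hpP : (p : 𝓞 L) ∈ P)
    (he : P.ramificationIdx (𝓞 K) = 1) :
    emultiplicity P (Ideal.span {((∏ p ∈ S, p : ℕ) : 𝓞 L)}) = 3 ∧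
    emultiplicity P (JJ K L) = 2 := by
  obtain ⟨𝔭, _, h𝔭⟩ := ((hS p).1 hpS).2
  have hu := under_of_tot K L p hp 𝔭 h𝔭 P hpP
  constructor
  · rw [emult_span_prod L S P hP, Finset.sum_eq_single_of_mem p hpS]
    · have h1 : Ideal.span {(p : 𝓞 L)} = (𝔭 ^ 3).map (algebraMap (𝓞 K) (𝓞 L)) := by
        rw [← h𝔭, Ideal.map_span]; simp
      have h𝔭0 : 𝔭 ≠ ⊥ := hu ▸ Ideal.under_ne_bot (𝓞 K) hP
      rw [h1, emult_map K L P hP _ (pow_ne_zero 3 h𝔭0), he, hu,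
        emultiplicity_pow_self_of_prime (Ideal.prime_of_isPrime h𝔭0 inferInstance)]
      norm_num
    · intro q hq hqp
      apply emult_span_zero
      intro hqP
      exact hqp (prime_unique L P q p ((hS q).1 hq).1 hp hqP hpP)
  · rw [JJ, emult_map K L P hP _ differentIdeal_ne_bot, he, hu,
      emult_diff_of_tot K hK3 p hp hp3 𝔭 h𝔭]
    norm_num

lemma main_identity [IsGalois ℚ L] (hK3 : Module.finrank ℚ K = 3)
    (hL6 : Module.finrank ℚ L = 6) (hK : ¬ IsGalois ℚ K) (h3 : ¬TotallyRamifiedAt 3 K)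
    (S : Finset ℕ) (hS : ∀ p : ℕ, p ∈ S ↔ p.Prime ∧ TotallyRamifiedAt p K) :
    Ideal.span {((∏ p ∈ S, p : ℕ) : 𝓞 L)} ^ 4 * (differentIdeal ℤ (𝓞 L)) ^ 12 =
      (∏ g : Gal(L/ℚ), g • JJ K L) ^ 3 := by
  classical
  have hG : Nat.card Gal(L/ℚ) = 6 := by rw [IsGalois.card_aut_eq_finrank, hL6]
  have hH := card_HH K L hK3 hL6
  have hn := HH_not_normal K L hK
  have hJ0 : JJ K L ≠ ⊥ := by
    intro h
    have := diff_tower K L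
    rw [h, Ideal.mul_bot] at this
    exact differentIdeal_ne_bot this
  have hr0 : Ideal.span {((∏ p ∈ S, p : ℕ) : 𝓞 L)} ≠ ⊥ := by
    rw [Ne, Ideal.span_singleton_eq_bot]
    have : (∏ p ∈ S, p : ℕ) ≠ 0 := Finset.prod_ne_zero_iff.2 fun p hp => ((hS p).1 hp).1.ne_zero
    exact_mod_cast this
  apply ideal_eq_of_emult
  · exact mul_ne_zero (pow_ne_zero _ hr0) (pow_ne_zero _ differentIdeal_ne_bot)
  · refine pow_ne_zero _ (Finset.prod_ne_zero_iff.2 fun g _ h => hJ0 ?_)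
    have := congrArg (g⁻¹ • ·) h
    simpa using this
  intro P hPp hP
  have hPr := Ideal.prime_of_isPrime hP hPp
  have hgP0 : ∀ g : Gal(L/ℚ), g • P ≠ ⊥ := by
    intro g h
    have := congrArg (g⁻¹ • ·) h
    exact hP (by simpa using this)
  have hgPp : ∀ g : Gal(L/ℚ), (g • P).IsPrime := fun g => inferInstance
  rw [emultiplicity_mul hPr, emultiplicity_pow hPr, emultiplicity_pow hPr, emultiplicity_pow hPr,
    Finset.emultiplicity_prod hPr]
  have hJg : ∀ g : Gal(L/ℚ), emultiplicity P (g • JJ K L) = emultiplicity (g⁻¹ • P) (JJ K L) := by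
    intro g
    rw [← emult_smul g⁻¹ P]; simp
  have hDg : ∀ g : Gal(L/ℚ), emultiplicity (g⁻¹ • P) (differentIdeal ℤ (𝓞 L)) =
      emultiplicity P (differentIdeal ℤ (𝓞 L)) := by
    intro g
    conv_lhs => rw [← smul_diff L g⁻¹]
    rw [emult_smul]
  simp_rw [hJg]
  have hcI := card_inertia_Q L P hP
  have hSr : ¬ 3 ∣ P.ramificationIdx ℤ →
      emultiplicity P (Ideal.span {((∏ p ∈ S, p : ℕ) : 𝓞 L)}) = 0 := by
    intro h
    rw [emult_span_prod L S P hP]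
    apply Finset.sum_eq_zero
    intro q hq
    apply emult_span_zero
    intro hqP
    exact h (three_dvd_of_tot K L q ((hS q).1 hq).1 ((hS q).1 hq).2 P hqP)
  have hdvd : Nat.card (P.inertia Gal(L/ℚ)) ∣ 6 := hG ▸ Subgroup.card_subgroup_dvd_card _
  have hcases : Nat.card (P.inertia Gal(L/ℚ)) = 1 ∨ Nat.card (P.inertia Gal(L/ℚ)) = 2 ∨
      Nat.card (P.inertia Gal(L/ℚ)) = 3 ∨ Nat.card (P.inertia Gal(L/ℚ)) = 6 := by
    generalize Nat.card (P.inertia Gal(L/ℚ)) = n at hdvd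
    have := Nat.le_of_dvd (by norm_num) hdvd
    interval_cases n <;> revert hdvd <;> decide
  obtain ⟨p, hp, hpP⟩ := exists_prime_mem L P hP
  have hpK : (p : 𝓞 K) ∈ P.under (𝓞 K) := by
    rw [Ideal.mem_comap]; simpa using hpP
  have htower := Ideal.ramificationIdx_tower (R := ℤ) (P.under (𝓞 K)) P
  rcases hcases with h | h | h | h
  · have hb : P.inertia Gal(L/ℚ) = ⊥ := Subgroup.card_eq_one.1 h
    rw [hSr (by rw [← hcI, h]; norm_num),
      emultiplicity_eq_zero.2 (not_dvd_diff_Z L P (by rw [← hcI, h])),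
      Finset.sum_eq_zero]
    · simp
    intro g _
    apply emult_J_of_le K L _ (hgP0 _)
    intro x hx
    rw [mem_inertia_conj, hb, Subgroup.mem_bot] at hx
    have : x = 1 := by simpa using hx
    rw [this]; exact one_mem _
  · rw [hSr (by rw [← hcI, h]; norm_num)]
    obtain ⟨T, hT, hT1, hT2⟩ := grp_inertia2 hG (HH K L) hH hn _ h
    have hsum : ∑ g : Gal(L/ℚ), emultiplicity (g⁻¹ • P) (JJ K L) =
        ∑ g : Gal(L/ℚ), if g ∈ T then 0 else emultiplicity P (differentIdeal ℤ (𝓞 L)) := by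
      apply Finset.sum_congr rfl
      intro g _
      split_ifs with hg
      · apply emult_J_of_le K L _ (hgP0 _)
        intro x hx
        rw [mem_inertia_conj] at hx
        exact hT1 g hg x hx
      · rw [← hDg g]
        refine (emult_J_of_inf_bot K L _ (hgP0 _) ?_).2
        rw [eq_bot_iff]
        rintro x ⟨hx, hxH⟩
        have hx := (mem_inertia_conj L P g x).1 hx
        exact hT2 g hg x hx hxH
    have hcard : (Finset.univ.filter fun g : Gal(L/ℚ) => g ∉ T).card = 4 := by
      rw [Finset.filter_not, Finset.card_sdiff_of_subset (Finset.filter_subset _ _),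
        Finset.filter_mem_eq_inter, Finset.univ_inter, hT, Finset.card_univ,
        ← Nat.card_eq_fintype_card, hG]
    rw [hsum, Finset.sum_ite, Finset.sum_const_zero, Finset.sum_const, hcard]
    simp only [mul_zero, zero_add, nsmul_eq_mul, ← mul_assoc]
    norm_num
  · have hinf : ∀ g : Gal(L/ℚ), (g • P).inertia Gal(L/ℚ) ⊓ HH K L = ⊥ := by
      intro g
      rw [eq_bot_iff]
      rintro x ⟨hx, hxH⟩
      have hx := (mem_inertia_conj L P g⁻¹ x).1 (by rwa [inv_inv])
      exact grp_inertia3 (HH K L) hH _ h _ x hx hxH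
    have hinf1 := hinf 1
    rw [one_smul] at hinf1
    obtain ⟨he, hJP⟩ := emult_J_of_inf_bot K L P hP hinf1
    have heK : (P.under (𝓞 K)).ramificationIdx ℤ = 3 := by
      rw [he, ← hcI, h] at htower; omega
    have htot : TotallyRamifiedAt p K :=
      ⟨P.under (𝓞 K), inferInstance, tot_of_ramIdx K hK3 p hp _ hpK heK⟩
    have hp3 : p ≠ 3 := by rintro rfl; exact h3 htot
    obtain ⟨h5, h6⟩ := emult_tot K L hK3 p hp hp3 S hS ((hS p).2 ⟨hp, htot⟩) P hP hpP he
    have hsum : ∀ g : Gal(L/ℚ), emultiplicity (g⁻¹ • P) (JJ K L) = 2 := by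
      intro g
      rw [(emult_J_of_inf_bot K L _ (hgP0 _) (hinf g⁻¹)).2, hDg, ← hJP, h6]
    simp_rw [hsum]
    rw [h5, ← hJP, h6, Finset.sum_const, Finset.card_univ, ← Nat.card_eq_fintype_card, hG]
    norm_num
  · exfalso
    have htop : P.inertia Gal(L/ℚ) = ⊤ := Subgroup.eq_top_of_card_eq _ (by rw [h, hG])
    obtain ⟨a, b, s, t, e1, e2, e3, e4, e5⟩ := grp_gens hG (HH K L) hH hn
    have h3P := three_mem_of_inertia_top L hL6 P hP htop a b s t e1 e2 e3 e4 e5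
    have hp3 : p = 3 := prime_unique L P p 3 hp Nat.prime_three hpP (by simpa using h3P)
    have : IsGalois K L := IsGalois.tower_top_of_isGalois ℚ K L
    have he : P.ramificationIdx (𝓞 K) = 2 := by
      rw [← card_inertia_K K L P hP, card_inertia_inf, htop, top_inf_eq, hH]
    have heK : (P.under (𝓞 K)).ramificationIdx ℤ = 3 := by
      rw [he, ← hcI, h] at htower; omega
    apply h3
    subst hp3
    exact ⟨P.under (𝓞 K), inferInstance, tot_of_ramIdx K hK3 _ hp _ hpK heK⟩

end mainid

section norms
variable (K L : Type) [Field K] [NumberField K] [Field L] [NumberField L]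
    [Algebra K L] [IsScalarTower ℚ K L]

lemma absNorm_smul_gal (g : Gal(L/ℚ)) (I : Ideal (𝓞 L)) :
    Ideal.absNorm (g • I) = Ideal.absNorm I := by
  have h := Ideal.relNorm_smul ℤ g I
  have h2 := congrArg Ideal.absNorm h
  rwa [Ideal.absNorm_relNorm, Ideal.absNorm_relNorm] at h2

lemma absNorm_JJ (hK3 : Module.finrank ℚ K = 3) (hL6 : Module.finrank ℚ L = 6) :
    Ideal.absNorm (JJ K L) = (discr K).natAbs ^ 2 := by
  rw [JJ, Ideal.absNorm_algebraMap, NumberField.absNorm_differentIdeal K,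
    ← finrank_KL K L hK3 hL6,
    IsFractionRing.finrank_eq (𝓞 K) K (𝓞 L) L]

lemma abs_identity [IsGalois ℚ L] (hK3 : Module.finrank ℚ K = 3)
    (hL6 : Module.finrank ℚ L = 6) (hK : ¬ IsGalois ℚ K) (h3 : ¬TotallyRamifiedAt 3 K)
    (S : Finset ℕ) (hS : ∀ p : ℕ, p ∈ S ↔ p.Prime ∧ TotallyRamifiedAt p K) :
    (∏ p ∈ S, p) ^ 2 * (discr L).natAbs = (discr K).natAbs ^ 3 := by
  have h := congrArg Ideal.absNorm (main_identity K L hK3 hL6 hK h3 S hS)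
  rw [map_mul, map_pow, map_pow, map_pow, map_prod, NumberField.absNorm_differentIdeal L,
    Ideal.absNorm_span_natCast, RingOfIntegers.rank, hL6] at h
  simp_rw [absNorm_smul_gal, absNorm_JJ K L hK3 hL6] at h
  rw [Finset.prod_const, Finset.card_univ, ← Nat.card_eq_fintype_card,
    IsGalois.card_aut_eq_finrank, hL6] at h
  apply Nat.pow_left_injective (n := 12) (by norm_num)
  change (_ * _) ^ 12 = (_ ^ 3) ^ 12
  rw [mul_pow, ← pow_mul, ← pow_mul]
  rw [← pow_mul, ← pow_mul, ← pow_mul] at h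
  exact h

end norms


end Helpers

theorem disc_galois_closure_eq
    (K Kt : Type) [Field K] [NumberField K] [Field Kt] [NumberField Kt]
    [Algebra K Kt] [IsScalarTower ℚ K Kt]
    (hK3 : Module.finrank ℚ K = 3) (hKnotGal : ¬IsGalois ℚ K)
    (hGal : IsGalois ℚ Kt) (hKt6 : Module.finrank ℚ Kt = 6)
    (h3 : ¬TotallyRamifiedAt 3 K)
    (S : Finset ℕ) (hS : ∀ p : ℕ, p ∈ S ↔ p.Prime ∧ TotallyRamifiedAt p K)
    (r : ℕ) (hr : r = ∏ p ∈ S, p) :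
    (r : ℤ) ^ 2 * NumberField.discr Kt = NumberField.discr K ^ 3 := by
  have habs := abs_identity K Kt hK3 hKt6 hKnotGal h3 S hS
  have hsign := sign_eq K Kt hK3 hKt6 hKnotGal
  have hrpos : 0 < r := by
    rw [hr]
    exact Finset.prod_pos fun p hp => ((hS p).1 hp).1.pos
  rw [← hr] at habs
  rw [← Int.sign_mul_natAbs ((r : ℤ) ^ 2 * discr Kt), ← Int.sign_mul_natAbs (discr K ^ 3),
    Int.natAbs_mul, Int.natAbs_pow, Int.natAbs_pow, Int.natAbs_natCast, habs, Int.sign_mul,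
    hsign, Int.sign_eq_one_of_pos (by positivity : (0 : ℤ) < (r : ℤ) ^ 2), one_mul]
  congr 1
  rcases lt_trichotomy (discr K) 0 with h | h | h
  · rw [Int.sign_eq_neg_one_of_neg h, Int.sign_eq_neg_one_of_neg (Odd.pow_neg (by decide) h)]
  · rw [h]; simp
  · rw [Int.sign_eq_one_of_pos h, Int.sign_eq_one_of_pos (by positivity)]
end

section
/- Let K be a non-cyclic cubic field with Galois closure K̃, and let p ≠ 3 be a prime that is totally ramified in K. Then |Disc(K̃)| ≥ 3·p⁴, where Disc denotes the discriminant of the ring of integers. (Consequently, no prime p ≠ 3 with 3p⁴ > X can be totally ramified in a non-cyclic cubic field whose Galois closure has absolute discriminant less than X.) -/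
open NumberField

lemma aux_pow_dvd_discr (M : Type*) [Field M] [NumberField M] (p : ℕ) (hp : p.Prime)
    (I : Ideal (𝓞 M)) (e : ℕ) (hI : I ^ e ∣ Ideal.span {(p : 𝓞 M)})
    (hN : p ∣ Ideal.absNorm I) : p ^ (e - 1) ∣ (discr M).natAbs := by
  have hpZ : Prime (p : ℤ) := Nat.prime_iff_prime_int.mp hp
  have hbot : Ideal.span {(p : ℤ)} ≠ ⊥ := by
    simpa using hp.ne_zero
  have hprime : (Ideal.span {(p : ℤ)}).IsPrime := by
    rwa [Ideal.span_singleton_prime hpZ.ne_zero]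
  have : (Ideal.span {(p : ℤ)}).IsMaximal := hprime.isMaximal hbot
  have h1 : I ^ (e - 1) ∣ differentIdeal ℤ (𝓞 M) := by
    refine pow_sub_one_dvd_differentIdeal ℤ (p := Ideal.span {(p : ℤ)}) I e hbot ?_
    simpa [Ideal.map_span] using hI
  have h2 := map_dvd (Ideal.absNorm (S := 𝓞 M)) h1
  rw [map_pow, absNorm_differentIdeal M] at h2
  exact (pow_dvd_pow_of_dvd hN _).trans h2

lemma aux_norm (M : Type*) [Field M] [NumberField M] (p : ℕ)
    (I : Ideal (𝓞 M)) (n : ℕ) (hn : n ≠ 0) (hM : Module.finrank ℚ M = n)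
    (hI : I ^ n = Ideal.span {(p : 𝓞 M)}) : Ideal.absNorm I = p := by
  have h := congrArg Ideal.absNorm hI
  rw [map_pow, Ideal.absNorm_span_natCast, RingOfIntegers.rank, hM] at h
  exact Nat.pow_left_injective hn h

lemma aux_quadratic (F : Type*) [Field F] [NumberField F] (hF : Module.finrank ℚ F = 2)
    (p : ℕ) (hp : p.Prime) (h : p ∣ (discr F).natAbs) :
    ∃ Q : Ideal (𝓞 F), Q ^ 2 = Ideal.span {(p : 𝓞 F)} := by
  have hpZ : Prime (p : ℤ) := Nat.prime_iff_prime_int.mp hp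
  have hbot : Ideal.span {(p : ℤ)} ≠ ⊥ := by
    simpa using hp.ne_zero
  have h' : ¬ ¬ (p : ℤ) ∣ discr F := not_not.mpr (Int.natCast_dvd.mpr h)
  rw [not_dvd_discr_iff_forall_liesOver F (𝓞 F) hpZ] at h'
  push Not at h'
  obtain ⟨P, hPm, hPo, hPu⟩ := h'
  rw [← Ideal.ramificationIdx_eq_one_iff,
    ← Ideal.ramificationIdx'_eq_ramificationIdx (Ideal.span {(p : ℤ)}) P hbot] at hPu
  have hle : (Ideal.span {(p : ℤ)}).map (algebraMap ℤ (𝓞 F)) ≤ P :=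
    Ideal.map_le_iff_le_comap.mpr hPo.over.le
  have h2 := (Ideal.ramificationIdx'_ne_one_iff hle).mp hPu
  have hmap : (Ideal.span {(p : ℤ)}).map (algebraMap ℤ (𝓞 F)) = Ideal.span {(p : 𝓞 F)} := by
    simp [Ideal.map_span]
  rw [hmap] at h2
  obtain ⟨J, hJ⟩ := Ideal.dvd_iff_le.mpr h2
  refine ⟨P, ?_⟩
  have hN := congrArg Ideal.absNorm hJ
  rw [map_mul, map_pow, Ideal.absNorm_span_natCast, RingOfIntegers.rank, hF,
    Ideal.absNorm_eq_pow_inertiaDeg' P hp] at hN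
  set f := (Ideal.span {(p : ℤ)}).inertiaDeg' P with hf
  have hf0 : f ≠ 0 := by
    intro h0
    have h3 := Ideal.absNorm_eq_pow_inertiaDeg' P hp
    rw [← hf, h0, pow_zero, Ideal.absNorm_eq_one_iff] at h3
    exact hPm.ne_top h3
  obtain ⟨g, hg⟩ := Nat.exists_eq_succ_of_ne_zero hf0
  have hJ1 : Ideal.absNorm J = 1 := by
    have hp2 : 0 < p ^ 2 := pow_pos hp.pos 2
    rw [hg, Nat.succ_eq_add_one, pow_succ p g, mul_pow] at hN
    have : p ^ 2 * ((p ^ g) ^ 2 * Ideal.absNorm J) = p ^ 2 * 1 := by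
      rw [mul_one]; nlinarith [hN]
    exact Nat.eq_one_of_mul_eq_one_left (Nat.eq_of_mul_eq_mul_left hp2 this)
  rw [Ideal.absNorm_eq_one_iff] at hJ1
  rw [hJ, hJ1, Ideal.mul_top]

lemma aux_quadratic_subfield (L : Type*) [Field L] [NumberField L] [IsGalois ℚ L]
    (h : Module.finrank ℚ L = 6) :
    ∃ F : IntermediateField ℚ L, Module.finrank ℚ F = 2 ∧ Module.finrank F L = 3 := by
  have hc : Nat.card Gal(L/ℚ) = 6 := by rw [IsGalois.card_aut_eq_finrank, h]
  have : Fact (Nat.Prime 3) := ⟨Nat.prime_three⟩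
  obtain ⟨H, hH⟩ := Sylow.exists_subgroup_card_pow_prime (G := Gal(L/ℚ)) 3 (n := 1)
    (by rw [hc]; norm_num)
  have h1 : Module.finrank (IntermediateField.fixedField H) L = 3 := by
    rw [IntermediateField.finrank_fixedField_eq_card, hH, pow_one]
  have h2 := Module.finrank_mul_finrank ℚ (IntermediateField.fixedField H) L
  rw [h, h1] at h2
  exact ⟨_, by omega, h1⟩

lemma aux_discr_pow (K L : Type*) [Field K] [NumberField K] [Field L] [NumberField L]
    [Algebra K L] : (discr K).natAbs ^ Module.finrank K L ∣ (discr L).natAbs := by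
  rw [natAbs_discr_eq_absNorm_differentIdeal_mul_natAbs_discr_pow K (𝓞 K) L (𝓞 L)]
  exact Dvd.intro_left _ rfl

theorem disc_galois_closure_lower_bound
    (K Kt : Type) [Field K] [NumberField K] [Field Kt] [NumberField Kt]
    [Algebra K Kt] [IsScalarTower ℚ K Kt]
    (hK3 : Module.finrank ℚ K = 3) (hKnotGal : ¬IsGalois ℚ K)
    (hGal : IsGalois ℚ Kt) (hKt6 : Module.finrank ℚ Kt = 6)
    (p : ℕ) (hp : p.Prime) (hp3 : p ≠ 3) (hram : TotallyRamifiedAt p K) :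
    3 * (p : ℤ) ^ 4 ≤ |NumberField.discr Kt| := by
  obtain ⟨P, -, hP⟩ := hram
  obtain ⟨F, hF2, hF3⟩ := aux_quadratic_subfield Kt hKt6
  have hKKt : Module.finrank K Kt = 2 := by
    have := Module.finrank_mul_finrank ℚ K Kt
    rw [hK3, hKt6] at this
    omega
  have hp4 : p ^ 4 ∣ (discr Kt).natAbs := by
    have h1 := aux_pow_dvd_discr K p hp P 3 hP.symm.dvd
      (aux_norm K p P 3 (by norm_num) hK3 hP.symm).symm.dvd
    have h2 := aux_discr_pow K Kt
    rw [hKKt] at h2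
    have h3 := (pow_dvd_pow_of_dvd h1 2).trans h2
    rwa [← pow_mul] at h3
  have hd3 : (discr F).natAbs ^ 3 ∣ (discr Kt).natAbs := by
    have h2 := aux_discr_pow F Kt
    rwa [hF3] at h2
  have hdpos : 0 < (discr Kt).natAbs := Int.natAbs_pos.mpr (discr_ne_zero Kt)
  have hd : 3 ≤ (discr F).natAbs := by
    have := abs_discr_gt_two (K := F) (by omega)
    rw [Int.abs_eq_natAbs] at this
    omega
  suffices h : 3 * p ^ 4 ≤ (discr Kt).natAbs by
    rw [Int.abs_eq_natAbs]
    exact_mod_cast h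
  by_cases hpd : p ∣ (discr F).natAbs
  · by_cases hp2 : p = 2
    · subst hp2
      have h4 : 4 ≤ (discr F).natAbs := by omega
      have h5 := Nat.le_of_dvd hdpos hd3
      have h6 := Nat.pow_le_pow_left h4 3
      omega
    · have hp5 : 3 ≤ p := by have := hp.two_le; omega
      obtain ⟨Q, hQ⟩ := aux_quadratic F hF2 p hp hpd
      have hP' : (P.map (algebraMap (𝓞 K) (𝓞 Kt))) ^ 3 = Ideal.span {(p : 𝓞 Kt)} := by
        rw [← Ideal.map_pow, ← hP]; simp [Ideal.map_span]
      have hQ' : (Q.map (algebraMap (𝓞 F) (𝓞 Kt))) ^ 2 = Ideal.span {(p : 𝓞 Kt)} := by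
        rw [← Ideal.map_pow, hQ]; simp [Ideal.map_span]
      set P' := P.map (algebraMap (𝓞 K) (𝓞 Kt))
      set Q' := Q.map (algebraMap (𝓞 F) (𝓞 Kt))
      have hPQ : P' ∣ Q' := by
        rw [← UniqueFactorizationMonoid.pow_dvd_pow_iff_dvd (n := 2) (by norm_num), hQ', ← hP']
        exact pow_dvd_pow _ (by norm_num)
      obtain ⟨R, hR⟩ := hPQ
      have hP0 : P' ≠ 0 := by
        intro h0
        rw [h0, zero_pow (by norm_num)] at hP'
        have : (p : 𝓞 Kt) = 0 := by simpa using hP'.symm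
        exact hp.ne_zero (by exact_mod_cast this)
      have hR2 : R ^ 2 = P' := by
        have : P' ^ 2 * R ^ 2 = P' ^ 2 * P' := by
          rw [← mul_pow, ← hR, hQ', ← hP', ← pow_succ]
        exact mul_left_cancel₀ (pow_ne_zero 2 hP0) this
      have hR6 : R ^ 6 = Ideal.span {(p : 𝓞 Kt)} := by
        rw [← hP', ← hR2, ← pow_mul]
      have h5 := Nat.le_of_dvd hdpos (aux_pow_dvd_discr Kt p hp R 6 hR6.dvd
        (aux_norm Kt p R 6 (by norm_num) hKt6 hR6).symm.dvd)
      refine le_trans ?_ h5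
      calc 3 * p ^ 4 ≤ p * p ^ 4 := Nat.mul_le_mul_right _ hp5
        _ = p ^ (6 - 1) := by norm_num; ring
  · have hcop : Nat.Coprime ((discr F).natAbs ^ 3) (p ^ 4) :=
      (Nat.Coprime.pow 4 3 ((Nat.Prime.coprime_iff_not_dvd hp).mpr hpd)).symm
    have h5 := Nat.le_of_dvd hdpos (hcop.mul_dvd_of_dvd_of_dvd hd3 hp4)
    refine le_trans (Nat.mul_le_mul_right _ ?_) h5
    have := Nat.pow_le_pow_left hd 3
    omega
end
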